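/- arXiv:1705.01594 — 2 statements merged into one kernel-verified Lean document; each statement's English description precedes it below -/
import Mathlib

section
/- Let R be a commutative Noetherian ring, I ⊆ J two ideals of R, and K an R-module with 2 ≤ cd(I, K) = t (i.e., H^t_I(K) ≠ 0 and H^i_I(K) = 0 for all i > t, with t ≥ 2). Then Tor_i^R(R/J, H^t_I(K)) = 0 for i = 0 and i = 1. -/
open CategoryTheory

noncomputable section

universe u

/-- `Tor_i^R(A, B)` as an object of `ModuleCat R`. -/
def TorMod (R : Type u) [CommRing R] (i : ℕ) (A B : ModuleCat.{u} R) : ModuleCat.{u} R :=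
  ((Tor (ModuleCat.{u} R) i).obj A).obj B

/-- `Ext^i_R(A, B)` as an object of `ModuleCat R`. -/
def ExtMod (R : Type u) [CommRing R] (i : ℕ) (A B : ModuleCat.{u} R) : ModuleCat.{u} R :=
  ((Ext R (ModuleCat.{u} R) i).obj (Opposite.op A)).obj B

/-- `H^i_I(M)`, the `i`-th local cohomology of `M` with support in `I`. -/
def LC (R : Type u) [CommRing R] (I : Ideal R) (i : ℕ) (M : ModuleCat.{u} R) : ModuleCat.{u} R :=
  (localCohomology I i).obj M

/-- `M` is `I`-cofinite: `Supp M ⊆ V(I)` and all `Ext^i_R(R/I, M)` are finitely generated. -/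
def IsCofinite (R : Type u) [CommRing R] (I : Ideal R) (M : ModuleCat.{u} R) : Prop :=
  Module.support R M ⊆ PrimeSpectrum.zeroLocus (I : Set R) ∧
    ∀ i : ℕ, Module.Finite R (ExtMod R i (ModuleCat.of R (R ⧸ I)) M)

/-- `Γ_I(M) = ⋃ₙ (0 :_M Iⁿ)`, the `I`-torsion submodule of `M`. -/
def torsionGamma (R : Type u) [CommRing R] (I : Ideal R) (M : Type u) [AddCommGroup M]
    [Module R M] : Submodule R M :=
  ⨆ n : ℕ, Submodule.torsionBySet R M ((I ^ n : Ideal R) : Set R)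

section Koszul
variable {R : Type u} [CommRing R]

def Kos (Z : ModuleCat.{u} R) : List R → ℕ → ModuleCat.{u} R
  | [], 0 => Z
  | [], _ + 1 => ModuleCat.of R PUnit
  | _ :: xs, 0 => Kos Z xs 0
  | _ :: xs, i + 1 => ModuleCat.of R (Kos Z xs (i + 1) × Kos Z xs i)

def dK (Z : ModuleCat.{u} R) : (xs : List R) → (i : ℕ) → Kos Z xs (i + 1) →ₗ[R] Kos Z xs i
  | [], _ => 0
  | x :: xs, 0 => (dK Z xs 0).coprod (x • LinearMap.id)
  | x :: xs, i + 1 =>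
      ((dK Z xs (i + 1)).coprod (x • LinearMap.id)).prod
        ((-(dK Z xs i)) ∘ₗ LinearMap.snd R (Kos Z xs (i + 2)) (Kos Z xs (i + 1)))

def mK {Z Z' : ModuleCat.{u} R} (f : Z →ₗ[R] Z') :
    (xs : List R) → (i : ℕ) → Kos Z xs i →ₗ[R] Kos Z' xs i
  | [], 0 => f
  | [], _ + 1 => 0
  | _ :: xs, 0 => mK f xs 0
  | _ :: xs, i + 1 => (mK f xs (i + 1)).prodMap (mK f xs i)

lemma dK_cons_zero (Z : ModuleCat.{u} R) (x : R) (xs : List R) (a : Kos Z xs 1) (b : Kos Z xs 0) :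
    dK Z (x :: xs) 0 ((a, b) : Kos Z xs 1 × Kos Z xs 0) = (dK Z xs 0 a + x • b : Kos Z xs 0) := rfl

lemma dK_cons_succ (Z : ModuleCat.{u} R) (x : R) (xs : List R) (i : ℕ)
    (a : Kos Z xs (i + 2)) (b : Kos Z xs (i + 1)) :
    dK Z (x :: xs) (i + 1) ((a, b) : Kos Z xs (i + 2) × Kos Z xs (i + 1)) =
      ((dK Z xs (i + 1) a + x • b, - dK Z xs i b) : Kos Z xs (i + 1) × Kos Z xs i) := rfl

lemma dK_dK (Z : ModuleCat.{u} R) (xs : List R) (i : ℕ) (c : Kos Z xs (i + 2)) :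
    dK Z xs i (dK Z xs (i + 1) c) = 0 := by
  induction xs generalizing i with
  | nil => rfl
  | cons x xs ih =>
    obtain ⟨a, b⟩ : Kos Z xs (i + 2) × Kos Z xs (i + 1) := c
    cases i with
    | zero =>
      rw [dK_cons_succ, dK_cons_zero]
      simp [ih]
      rfl
    | succ i =>
      rw [dK_cons_succ, dK_cons_succ]
      simp only [map_add, ih, map_smul, map_neg, zero_add, smul_neg, add_neg_cancel, neg_zero]
      rfl

lemma mK_dK {Z Z' : ModuleCat.{u} R} (f : Z →ₗ[R] Z') (xs : List R) (i : ℕ)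
    (c : Kos Z xs (i + 1)) : mK f xs i (dK Z xs i c) = dK Z' xs i (mK f xs (i + 1) c) := by
  induction xs generalizing i with
  | nil => exact map_zero _
  | cons x xs ih =>
    obtain ⟨a, b⟩ : Kos Z xs (i + 1) × Kos Z xs i := c
    cases i with
    | zero =>
      change mK f xs 0 (dK Z xs 0 a + x • b) = dK Z' xs 0 (mK f xs 1 a) + x • mK f xs 0 b
      simp [ih]
    | succ i =>
      change ((mK f xs (i + 1) (dK Z xs (i + 1) a + x • b), mK f xs i (- dK Z xs i b)) :
        Kos Z' xs (i + 1) × Kos Z' xs i) = (dK Z' xs (i + 1) (mK f xs (i + 2) a)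
          + x • mK f xs (i + 1) b, - dK Z' xs i (mK f xs (i + 1) b))
      simp [ih]

lemma mK_inj {Z Z' : ModuleCat.{u} R} (f : Z →ₗ[R] Z') (hf : Function.Injective f)
    (xs : List R) (i : ℕ) : Function.Injective (mK f xs i) := by
  induction xs generalizing i with
  | nil =>
    cases i with
    | zero => exact hf
    | succ i => exact fun a b _ => (Subsingleton.elim (α := PUnit) a b)
  | cons x xs ih =>
    cases i with
    | zero => exact ih 0
    | succ i => exact Function.Injective.prodMap (ih (i + 1)) (ih i)

lemma mK_surj {Z Z' : ModuleCat.{u} R} (f : Z →ₗ[R] Z') (hf : Function.Surjective f)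
    (xs : List R) (i : ℕ) : Function.Surjective (mK f xs i) := by
  induction xs generalizing i with
  | nil =>
    cases i with
    | zero => exact hf
    | succ i => exact fun b => ⟨b, (Subsingleton.elim (α := PUnit) _ _)⟩
  | cons x xs ih =>
    cases i with
    | zero => exact ih 0
    | succ i => exact Function.Surjective.prodMap (ih (i + 1)) (ih i)

lemma mK_exact {Z Z' Z'' : ModuleCat.{u} R} (f : Z →ₗ[R] Z') (g : Z' →ₗ[R] Z'')
    (h : Function.Exact f g) (xs : List R) (i : ℕ) :
    ∀ c : Kos Z' xs i, mK g xs i c = 0 → ∃ a, mK f xs i a = c := by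
  induction xs generalizing i with
  | nil =>
    cases i with
    | zero => exact fun c hc => (h c).1 hc
    | succ i => exact fun c _ => ⟨0, (Subsingleton.elim (α := PUnit) _ _)⟩
  | cons x xs ih =>
    cases i with
    | zero => exact fun c hc => ih 0 c hc
    | succ i =>
      intro c hc
      obtain ⟨a, b⟩ : Kos Z' xs (i + 1) × Kos Z' xs i := c
      have hc' : ((mK g xs (i + 1) a, mK g xs i b) : Kos Z'' xs (i + 1) × Kos Z'' xs i) = 0 := hc
      rw [Prod.mk_eq_zero] at hc'
      obtain ⟨a', rfl⟩ := ih (i + 1) a hc'.1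
      obtain ⟨b', rfl⟩ := ih i b hc'.2
      exact ⟨((a', b') : Kos Z xs (i + 1) × Kos Z xs i), rfl⟩

lemma mK_comp_zero {Z Z' Z'' : ModuleCat.{u} R} (f : Z →ₗ[R] Z') (g : Z' →ₗ[R] Z'')
    (h : ∀ z, g (f z) = 0) (xs : List R) (i : ℕ) (a : Kos Z xs i) :
    mK g xs i (mK f xs i a) = 0 := by
  induction xs generalizing i with
  | nil =>
    cases i with
    | zero => exact h a
    | succ i => rfl
  | cons x xs ih =>
    cases i with
    | zero => exact ih 0 a
    | succ i =>
      obtain ⟨a, b⟩ : Kos Z xs (i + 1) × Kos Z xs i := a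
      exact Prod.ext (ih (i + 1) a) (ih i b)

def cycK (Z : ModuleCat.{u} R) (xs : List R) : (i : ℕ) → Kos Z xs i → Prop
  | 0, _ => True
  | i + 1, c => dK Z xs i c = 0

def ExK (Z : ModuleCat.{u} R) (xs : List R) (i : ℕ) : Prop :=
  ∀ c, cycK Z xs i c → ∃ b, dK Z xs i b = c

lemma cycK_d (Z : ModuleCat.{u} R) (xs : List R) (i : ℕ) (b) : cycK Z xs i (dK Z xs i b) := by
  cases i with
  | zero => trivial
  | succ i => exact dK_dK Z xs i b

lemma cycK_sub (Z : ModuleCat.{u} R) (xs : List R) (i : ℕ) (a b) (ha : cycK Z xs i a)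
    (hb : cycK Z xs i b) : cycK Z xs i (a - b) := by
  cases i with
  | zero => trivial
  | succ i =>
    change dK Z xs i _ = 0 at *
    rw [map_sub, ha, hb, sub_zero]

lemma cycK_map {Z Z' : ModuleCat.{u} R} (f : Z →ₗ[R] Z') (xs : List R) (i : ℕ) (a)
    (ha : cycK Z xs i a) : cycK Z' xs i (mK f xs i a) := by
  cases i with
  | zero => trivial
  | succ i =>
    change dK _ xs i _ = 0 at *
    rw [← mK_dK, ha, map_zero]

lemma cycK_of_map {Z Z' : ModuleCat.{u} R} (f : Z →ₗ[R] Z') (hf : Function.Injective f)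
    (xs : List R) (i : ℕ) (a) (ha : cycK Z' xs i (mK f xs i a)) : cycK Z xs i a := by
  cases i with
  | zero => trivial
  | succ i =>
    change dK _ xs i _ = 0 at *
    rw [← mK_dK] at ha
    exact mK_inj f hf xs i (by rw [ha, map_zero])

lemma ExK_shift {Z Z' Z'' : ModuleCat.{u} R} (f : Z →ₗ[R] Z') (g : Z' →ₗ[R] Z'')
    (hf : Function.Injective f) (hg : Function.Surjective g) (h : Function.Exact f g)
    (xs : List R) (i : ℕ) (h1 : ExK Z' xs i) (h2 : ExK Z'' xs (i + 1)) : ExK Z xs i := by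
  intro c hc
  obtain ⟨b, hb⟩ := h1 _ (cycK_map f xs i c hc)
  obtain ⟨e, he⟩ := h2 (mK g xs (i + 1) b) (by
    change dK _ xs i _ = 0
    rw [← mK_dK, hb, mK_comp_zero f g h.apply_apply_eq_zero])
  obtain ⟨e, rfl⟩ := mK_surj g hg xs (i + 2) e
  obtain ⟨b', hb'⟩ := mK_exact f g h xs (i + 1) (b - dK _ xs (i + 1) e) (by
    rw [map_sub, mK_dK, he, sub_self])
  refine ⟨b', mK_inj f hf xs i ?_⟩
  rw [mK_dK, hb', map_sub, dK_dK, sub_zero, hb]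

lemma ExK_mid {Z Z' Z'' : ModuleCat.{u} R} (f : Z →ₗ[R] Z') (g : Z' →ₗ[R] Z'')
    (hf : Function.Injective f) (hg : Function.Surjective g) (h : Function.Exact f g)
    (xs : List R) (i : ℕ) (h1 : ExK Z xs i) (h2 : ExK Z'' xs i) : ExK Z' xs i := by
  intro c hc
  obtain ⟨e, he⟩ := h2 _ (cycK_map g xs i c hc)
  obtain ⟨e, rfl⟩ := mK_surj g hg xs (i + 1) e
  obtain ⟨a, ha⟩ := mK_exact f g h xs i (c - dK _ xs i e) (by
    rw [map_sub, mK_dK, he, sub_self])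
  obtain ⟨b, hb⟩ := h1 a (cycK_of_map f hf xs i a (by
    rw [ha]; exact cycK_sub _ _ _ _ _ hc (cycK_d _ _ _ _)))
  refine ⟨mK f xs _ b + e, ?_⟩
  rw [map_add, ← mK_dK, hb, ha, sub_add_cancel]

lemma Kos_subsingleton (Z : ModuleCat.{u} R) (xs : List R) (i : ℕ) (hi : xs.length < i) :
    Subsingleton (Kos Z xs i) := by
  induction xs generalizing i with
  | nil =>
    cases i with
    | zero => simp at hi
    | succ i => exact inferInstanceAs (Subsingleton PUnit)
  | cons x xs ih =>
    cases i with
    | zero => simp at hi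
    | succ i =>
      simp only [List.length_cons] at hi
      have := ih (i + 1) (by lia)
      have := ih i (by lia)
      exact inferInstanceAs (Subsingleton (Kos Z xs (i + 1) × Kos Z xs i))

lemma ExK_cons_of_exact (Z : ModuleCat.{u} R) (x : R) (xs : List R) (h : ∀ i, ExK Z xs i) (i : ℕ) :
    ExK Z (x :: xs) i := by
  intro c hc
  cases i with
  | zero =>
    obtain ⟨b, hb⟩ := h 0 c trivial
    refine ⟨((b, 0) : Kos Z xs 1 × Kos Z xs 0), ?_⟩
    rw [dK_cons_zero, smul_zero, add_zero]; exact hb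
  | succ i =>
    obtain ⟨a, b⟩ : Kos Z xs (i + 1) × Kos Z xs i := c
    have key : dK Z xs i a + x • b = 0 ∧ cycK Z xs i b := by
      cases i with
      | zero => exact ⟨hc, trivial⟩
      | succ i =>
        have hc' : ((dK Z xs (i + 1) a + x • b, - dK Z xs i b) :
          Kos Z xs (i + 1) × Kos Z xs i) = 0 := hc
        rw [Prod.mk_eq_zero] at hc'
        exact ⟨hc'.1, neg_eq_zero.1 hc'.2⟩
    obtain ⟨b', hb'⟩ := h i b key.2
    obtain ⟨a', ha'⟩ := h (i + 1) (a + x • b') (by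
      change dK Z xs i _ = 0
      rw [map_add, map_smul, hb', key.1])
    refine ⟨((a', -b') : Kos Z xs (i + 2) × Kos Z xs (i + 1)), ?_⟩
    rw [dK_cons_succ]
    refine Prod.ext ?_ ?_
    · change dK Z xs (i + 1) a' + x • -b' = a
      rw [ha']; simp
    · change - dK Z xs i (-b') = b
      rw [map_neg, hb', neg_neg]

lemma Kos_smul_bij (Z : ModuleCat.{u} R) (x : R) (h : Function.Bijective (fun z : Z => x • z))
    (xs : List R) (i : ℕ) : Function.Bijective (fun z : Kos Z xs i => x • z) := by
  induction xs generalizing i with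
  | nil =>
    cases i with
    | zero => exact h
    | succ i => exact ⟨fun a b _ => (Subsingleton.elim (α := PUnit) a b),
        fun b => ⟨b, (Subsingleton.elim (α := PUnit) _ _)⟩⟩
  | cons y xs ih =>
    cases i with
    | zero => exact ih 0
    | succ i => exact Function.Bijective.prodMap (ih (i + 1)) (ih i)

lemma ExK_cons_of_bij (Z : ModuleCat.{u} R) (x : R) (xs : List R)
    (h : Function.Bijective (fun z : Z => x • z)) (i : ℕ) : ExK Z (x :: xs) i := by
  intro c hc
  cases i with
  | zero =>
    obtain ⟨b, hb⟩ := (Kos_smul_bij Z x h xs 0).2 c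
    refine ⟨((0, b) : Kos Z xs 1 × Kos Z xs 0), ?_⟩
    rw [dK_cons_zero, map_zero, zero_add]; exact hb
  | succ i =>
    obtain ⟨a, b⟩ : Kos Z xs (i + 1) × Kos Z xs i := c
    have key : dK Z xs i a + x • b = 0 := by
      cases i with
      | zero => exact hc
      | succ i =>
        have hc' : ((dK Z xs (i + 1) a + x • b, - dK Z xs i b) :
          Kos Z xs (i + 1) × Kos Z xs i) = 0 := hc
        rw [Prod.mk_eq_zero] at hc'
        exact hc'.1
    obtain ⟨b', hb'⟩ := (Kos_smul_bij Z x h xs (i + 1)).2 a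
    simp only at hb'
    refine ⟨((0, b') : Kos Z xs (i + 2) × Kos Z xs (i + 1)), ?_⟩
    rw [dK_cons_succ]
    refine Prod.ext ?_ ?_
    · change dK Z xs (i + 1) 0 + x • b' = a
      rw [map_zero, zero_add, hb']
    · change - dK Z xs i b' = b
      apply (Kos_smul_bij Z x h xs i).1
      simp only
      rw [smul_neg, ← map_smul, hb', eq_comm]
      exact eq_neg_of_add_eq_zero_right key

end Koszul
section Gam
variable {R : Type u} [CommRing R]

def gam (I : Ideal R) (M : Type u) [AddCommGroup M] [Module R M] : Submodule R M where
  carrier := {m | ∃ k : ℕ, ∀ a ∈ I ^ k, a • m = 0}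
  zero_mem' := ⟨0, fun a _ => smul_zero a⟩
  add_mem' := by
    rintro m n ⟨k, hk⟩ ⟨l, hl⟩
    refine ⟨max k l, fun a ha => ?_⟩
    rw [smul_add, hk a (Ideal.pow_le_pow_right (le_max_left _ _) ha),
      hl a (Ideal.pow_le_pow_right (le_max_right _ _) ha), add_zero]
  smul_mem' := by
    rintro r m ⟨k, hk⟩
    exact ⟨k, fun a ha => by rw [smul_comm, hk a ha, smul_zero]⟩

variable {M N : Type u} [AddCommGroup M] [Module R M] [AddCommGroup N] [Module R N]

lemma mem_gam {I : Ideal R} {m : M} : m ∈ gam I M ↔ ∃ k : ℕ, ∀ a ∈ I ^ k, a • m = 0 := Iff.rfl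

lemma gam_map {I : Ideal R} (f : M →ₗ[R] N) {m : M} (h : m ∈ gam I M) : f m ∈ gam I N := by
  obtain ⟨k, hk⟩ := h
  exact ⟨k, fun a ha => by rw [← map_smul, hk a ha, map_zero]⟩

lemma gam_of_map {I : Ideal R} (f : M →ₗ[R] N) (hf : Function.Injective f) {m : M}
    (h : f m ∈ gam I N) : m ∈ gam I M := by
  obtain ⟨k, hk⟩ := h
  exact ⟨k, fun a ha => hf (by rw [map_smul, hk a ha, map_zero])⟩

lemma exists_uniform_pow [IsNoetherianRing R] (I : Ideal R) (𝔞 : Ideal R) (f : 𝔞 →ₗ[R] gam I M) :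
    ∃ k : ℕ, ∀ a ∈ I ^ k, ∀ x : 𝔞, a • f x = 0 := by
  obtain ⟨s, hs⟩ : (⊤ : Submodule R 𝔞).FG := Module.Finite.fg_top
  choose k hk using fun x : 𝔞 => (f x).2
  refine ⟨s.sup k, fun a ha x => ?_⟩
  have hx : x ∈ Submodule.span R (s : Set 𝔞) := hs ▸ Submodule.mem_top
  induction hx using Submodule.span_induction with
  | mem x hx =>
    exact Subtype.ext (hk x a (Ideal.pow_le_pow_right (Finset.le_sup hx) ha))
  | zero => simp
  | add x y _ _ h1 h2 => rw [map_add, smul_add, h1, h2, add_zero]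
  | smul r x _ h => rw [map_smul, smul_comm, h, smul_zero]

lemma gam_injective [IsNoetherianRing R] (I : Ideal R) (hM : Module.Injective R M) :
    Module.Injective R (gam I M) := by
  apply Module.Baer.injective
  intro 𝔞 f
  obtain ⟨k, hk⟩ := exists_uniform_pow I 𝔞 f
  obtain ⟨c, hc⟩ := Ideal.exists_pow_inf_eq_pow_smul I 𝔞
  have hc' := hc (k + c) (by lia)
  rw [Nat.add_sub_cancel] at hc'
  have hle : ∀ x : 𝔞, (x : R) ∈ I ^ (k + c) → f x = 0 := by
    intro x hx
    have h1 : (x : R) ∈ I ^ k • (𝔞 : Submodule R R) := by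
      have : (x : R) ∈ I ^ (k + c) • ⊤ ⊓ (𝔞 : Submodule R R) := ⟨by simpa using hx, x.2⟩
      rw [hc'] at this
      exact Submodule.smul_mono le_rfl inf_le_right this
    have h2 : ∀ y ∈ I ^ k • (𝔞 : Submodule R R), ∀ hy : y ∈ 𝔞, f ⟨y, hy⟩ = 0 := by
      intro y hy
      induction hy using Submodule.smul_induction_on' with
      | smul r hr n hn =>
        intro hy
        have : (⟨r • n, hy⟩ : 𝔞) = r • ⟨n, hn⟩ := rfl
        rw [this, map_smul, hk r hr]
      | add y1 h1' y2 h2' i1 i2 =>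
        intro hy
        have e1 : y1 ∈ 𝔞 := Submodule.smul_le_right h1'
        have e2 : y2 ∈ 𝔞 := Submodule.smul_le_right h2'
        have : (⟨y1 + y2, hy⟩ : 𝔞) = ⟨y1, e1⟩ + ⟨y2, e2⟩ := rfl
        rw [this, map_add, i1, i2, add_zero]
    exact h2 _ h1 x.2
  -- map from the image of `𝔞` in `R / I ^ (k + c)`
  let q : 𝔞 →ₗ[R] R ⧸ I ^ (k + c) := (Submodule.mkQ (I ^ (k + c))) ∘ₗ 𝔞.subtype
  have hq : LinearMap.ker q ≤ LinearMap.ker ((gam I M).subtype ∘ₗ f) := by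
    intro x hx
    have : (x : R) ∈ I ^ (k + c) := by
      simpa [q, Ideal.Quotient.eq_zero_iff_mem] using hx
    simp [hle x this]
  let f' : (𝔞 ⧸ LinearMap.ker q) →ₗ[R] M := (LinearMap.ker q).liftQ _ hq
  let q' : (𝔞 ⧸ LinearMap.ker q) →ₗ[R] R ⧸ I ^ (k + c) := (LinearMap.ker q).liftQ q le_rfl
  have hq' : Function.Injective q' := by
    rw [← LinearMap.ker_eq_bot]
    exact Submodule.ker_liftQ_eq_bot _ _ _ le_rfl
  obtain ⟨h, hh⟩ := hM.out q' hq' f'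
  refine ⟨((h ∘ₗ Submodule.mkQ (I ^ (k + c))).codRestrict (gam I M) ?_), ?_⟩
  · intro r
    refine ⟨k + c, fun a ha => ?_⟩
    rw [← map_smul, LinearMap.comp_apply]
    have : Submodule.mkQ (I ^ (k + c)) (a • r) = 0 := by
      exact (Submodule.Quotient.mk_eq_zero _).2 (Ideal.mul_mem_right _ _ ha)
    rw [this, map_zero]
  · intro x hx
    apply Subtype.ext
    have := hh (Submodule.Quotient.mk ⟨x, hx⟩)
    exact this

lemma quot_injective (N : Submodule R M) (hN : Module.Injective R N) (hM : Module.Injective R M) :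
    Module.Injective R (M ⧸ N) := by
  obtain ⟨p, hp⟩ := hN.out N.subtype N.injective_subtype LinearMap.id
  let s : (M ⧸ N) →ₗ[R] M := N.liftQ (LinearMap.id - N.subtype ∘ₗ p) (by
    intro n hn
    have := hp ⟨n, hn⟩
    simp only [Submodule.subtype_apply, LinearMap.id_apply] at this
    simp [this])
  have hs : ∀ y, N.mkQ (s y) = y := by
    intro y
    obtain ⟨y, rfl⟩ := N.mkQ_surjective y
    have : s (N.mkQ y) = y - p y := rfl
    rw [this, map_sub, sub_eq_self]
    simp
  constructor
  intro X Y _ _ _ _ f hf g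
  obtain ⟨h, hh⟩ := hM.out f hf (s ∘ₗ g)
  exact ⟨N.mkQ ∘ₗ h, fun x => by simp only [LinearMap.comp_apply, hh, hs]⟩

def TF (xs : List R) (M : Type u) [AddCommGroup M] [Module R M] : Prop :=
  ∀ m : M, (∀ x ∈ xs, x • m = 0) → m = 0

lemma TF_of_gam (I J : Ideal R) (hIJ : I ≤ J) (xs : List R)
    (hxs : Ideal.span {x | x ∈ xs} = J) (h : gam I M = ⊥) : TF xs M := by
  intro m hm
  have : m ∈ gam I M := by
    refine ⟨1, fun a ha => ?_⟩
    rw [pow_one] at ha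
    have ha' := hIJ ha
    rw [← hxs] at ha'
    clear ha
    induction ha' using Submodule.span_induction with
    | mem x hx => exact hm x hx
    | zero => simp
    | add x y _ _ h1 h2 => rw [add_smul, h1, h2, add_zero]
    | smul r x _ h => rw [smul_eq_mul, mul_smul, h, smul_zero]
  rw [h] at this
  exact this

lemma gam_quot (I : Ideal R) [IsNoetherianRing R] : gam I (M ⧸ gam I M) = ⊥ := by
  rw [eq_bot_iff]
  intro y hy
  obtain ⟨k, hk⟩ := hy
  obtain ⟨m, rfl⟩ := (gam I M).mkQ_surjective y
  have h1 : ∀ a ∈ I ^ k, a • m ∈ gam I M := by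
    intro a ha
    have := hk a ha
    rw [← map_smul] at this
    exact (Submodule.Quotient.mk_eq_zero _).1 this
  obtain ⟨l, hl⟩ := exists_uniform_pow I (I ^ k)
    (((LinearMap.toSpanSingleton R M m) ∘ₗ (I ^ k).subtype).codRestrict (gam I M)
      (fun x => h1 x x.2))
  have : m ∈ gam I M := by
    refine ⟨l + k, fun a ha => ?_⟩
    rw [pow_add] at ha
    induction ha using Submodule.mul_induction_on' with
    | mem_mul_mem a ha b hb =>
      have := congrArg Subtype.val (hl a ha ⟨b, hb⟩)
      rw [mul_smul]
      exact this
    | add a _ b _ h1 h2 => rw [add_smul, h1, h2, add_zero]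
  simpa using this

lemma ExK_of_injective [IsNoetherianRing R] (xs : List R) : ∀ (F : ModuleCat.{u} R),
    Module.Injective R F → TF xs F → ∀ i, ExK F xs i := by
  induction xs with
  | nil =>
    intro F _ hT i c _
    cases i with
    | zero => exact ⟨0, (hT c (by simp)).symm⟩
    | succ i => exact ⟨0, Subsingleton.elim (α := PUnit) _ _⟩
  | cons x xs ih =>
    intro F hF hT i
    let G := gam (Ideal.span {x}) F
    have hG : Module.Injective R G := gam_injective _ hF
    have hmem : ∀ m : F, m ∈ G ↔ ∃ k : ℕ, x ^ k • m = 0 := by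
      intro m
      constructor
      · rintro ⟨k, hk⟩
        exact ⟨k, hk _ (Ideal.pow_mem_pow (Ideal.mem_span_singleton_self x) k)⟩
      · rintro ⟨k, hk⟩
        refine ⟨k, fun a ha => ?_⟩
        rw [Ideal.span_singleton_pow, Ideal.mem_span_singleton'] at ha
        obtain ⟨b, rfl⟩ := ha
        rw [mul_smul, hk, smul_zero]
    have hTG : TF xs G := by
      rintro ⟨m, hm⟩ hz
      obtain ⟨k, hk⟩ := (hmem m).1 hm
      have hz' : ∀ y ∈ xs, y • m = 0 := fun y hy => congrArg Subtype.val (hz y hy)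
      apply Subtype.ext
      change m = 0
      clear hz hm
      induction k with
      | zero => simpa using hk
      | succ k ihk =>
        apply ihk
        apply hT
        intro y hy
        rw [List.mem_cons] at hy
        rcases hy with rfl | hy
        · rw [← mul_smul, ← pow_succ', hk]
        · rw [smul_comm, hz' y hy, smul_zero]
    refine ExK_mid (Z := ModuleCat.of R G) (Z' := F) (Z'' := ModuleCat.of R (F ⧸ G))
      G.subtype G.mkQ G.injective_subtype G.mkQ_surjective (LinearMap.exact_subtype_mkQ G)
      (x :: xs) i (ExK_cons_of_exact _ _ _ (ih (ModuleCat.of R G) hG hTG) _)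
      (ExK_cons_of_bij _ _ _ ⟨?_, ?_⟩ _)
    · refine (injective_iff_map_eq_zero (LinearMap.lsmul R (F ⧸ G) x)).2 ?_
      intro y hy
      obtain ⟨m, rfl⟩ := G.mkQ_surjective y
      rw [LinearMap.lsmul_apply, ← map_smul] at hy
      have hy' : x • m ∈ G := (Submodule.Quotient.mk_eq_zero _).1 hy
      obtain ⟨k, hk⟩ := (hmem _).1 hy'
      have : m ∈ G := (hmem m).2 ⟨k + 1, by rw [pow_succ, mul_smul, hk]⟩
      simpa using this
    · intro y
      obtain ⟨m, rfl⟩ := G.mkQ_surjective y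
      -- stabilization of annihilators
      obtain ⟨k, hk⟩ : ∃ k : ℕ, ∀ r : R, x ^ (k + 1) * r = 0 → x ^ k * r = 0 := by
        let A : ℕ →o Ideal R := ⟨fun k => LinearMap.ker (LinearMap.lsmul R R (x ^ k)), by
          intro a b hab r hr
          simp only [LinearMap.mem_ker, LinearMap.lsmul_apply, smul_eq_mul] at hr ⊢
          rw [← Nat.sub_add_cancel hab, pow_add, mul_assoc, hr, mul_zero]⟩
        obtain ⟨k, hk⟩ := monotone_stabilizes_iff_noetherian.2 ‹_› A
        refine ⟨k, fun r hr => ?_⟩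
        have : r ∈ A (k + 1) := hr
        rw [← hk (k + 1) (by lia)] at this
        exact this
      let q : R →ₗ[R] R := LinearMap.lsmul R R (x ^ (k + 1))
      let q' : (R ⧸ LinearMap.ker q) →ₗ[R] R := (LinearMap.ker q).liftQ q le_rfl
      have hq' : Function.Injective q' := by
        rw [← LinearMap.ker_eq_bot]
        exact Submodule.ker_liftQ_eq_bot _ _ _ le_rfl
      let f : R →ₗ[R] F := LinearMap.toSpanSingleton R F (x ^ k • m)
      have hf : LinearMap.ker q ≤ LinearMap.ker f := by
        intro r hr
        have := hk r hr
        simp only [LinearMap.mem_ker, f, LinearMap.toSpanSingleton_apply]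
        rw [← mul_smul, mul_comm, this, zero_smul]
      obtain ⟨h, hh⟩ := hF.out q' hq' ((LinearMap.ker q).liftQ f hf)
      have e : h (x ^ (k + 1)) = x ^ k • m := by
        have := hh (Submodule.Quotient.mk 1)
        have e1 : q' (Submodule.Quotient.mk 1) = x ^ (k + 1) := mul_one _
        have e2 : (LinearMap.ker q).liftQ f hf (Submodule.Quotient.mk 1) = x ^ k • m := one_smul _ _
        rw [e1, e2] at this
        exact this
      refine ⟨G.mkQ (h 1), ?_⟩
      simp only
      rw [← map_smul, ← sub_eq_zero, ← map_sub]
      have : x • h 1 - m ∈ G := by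
        refine (hmem _).2 ⟨k, ?_⟩
        rw [smul_sub, ← mul_smul, ← pow_succ, ← e, ← map_smul, sub_eq_zero]
        simp
      exact (Submodule.Quotient.mk_eq_zero _).2 this

end Gam
section TorPart
open TensorProduct
variable {R : Type u} [CommRing R]

def mulT (J : Ideal R) (Z : Type u) [AddCommGroup Z] [Module R Z] : J ⊗[R] Z →ₗ[R] Z :=
  TensorProduct.lift ((LinearMap.lsmul R Z) ∘ₗ J.subtype)

lemma mulT_tmul (J : Ideal R) (Z : Type u) [AddCommGroup Z] [Module R Z] (j : J) (z : Z) :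
    mulT J Z (j ⊗ₜ z) = (j : R) • z := rfl

lemma mulT_nat (J : Ideal R) {Z Y : Type u} [AddCommGroup Z] [Module R Z] [AddCommGroup Y]
    [Module R Y] (f : Z →ₗ[R] Y) (w : J ⊗[R] Z) :
    mulT J Y (f.lTensor J w) = f (mulT J Z w) := by
  induction w with
  | zero => simp
  | add a b ha hb => simp only [map_add, ha, hb]
  | tmul j z => simp [mulT_tmul]

lemma smul_tens (J : Ideal R) (Z : Type u) [AddCommGroup Z] [Module R Z] (x : J)
    (w : J ⊗[R] Z) : (x : R) • w = x ⊗ₜ[R] (mulT J Z w) := by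
  induction w with
  | zero => simp
  | add a b ha hb => simp only [map_add, smul_add, ha, hb, tmul_add]
  | tmul j z =>
    rw [mulT_tmul, ← TensorProduct.smul_tmul, TensorProduct.smul_tmul']
    congr 1
    exact Subtype.ext (mul_comm _ _)

def e0K (Z : ModuleCat.{u} R) : (xs : List R) → Kos Z xs 0 →ₗ[R] Z
  | [] => LinearMap.id
  | _ :: xs => e0K Z xs

lemma e0K_bij (Z : ModuleCat.{u} R) (xs : List R) : Function.Bijective (e0K Z xs) := by
  induction xs with
  | nil => exact Function.bijective_id
  | cons x xs ih => exact ih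

def phiK (J : Ideal R) (Z : ModuleCat.{u} R) : (xs : List R) → (∀ x ∈ xs, x ∈ J) →
    Kos Z xs 1 →ₗ[R] J ⊗[R] Z
  | [], _ => 0
  | x :: xs, h => (phiK J Z xs (fun y hy => h y (List.mem_cons_of_mem _ hy))).coprod
      ((TensorProduct.mk R J Z ⟨x, h x List.mem_cons_self⟩) ∘ₗ e0K Z xs)

lemma phiK_cons (J : Ideal R) (Z : ModuleCat.{u} R) (x : R) (xs : List R) (h)
    (a : Kos Z xs 1) (b : Kos Z xs 0) :
    phiK J Z (x :: xs) h ((a, b) : Kos Z xs 1 × Kos Z xs 0) =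
      phiK J Z xs (fun y hy => h y (List.mem_cons_of_mem _ hy)) a +
        (⟨x, h x List.mem_cons_self⟩ : J) ⊗ₜ e0K Z xs b := rfl

lemma mulT_phiK (J : Ideal R) (Z : ModuleCat.{u} R) (xs : List R) (h) (c : Kos Z xs 1) :
    mulT J Z (phiK J Z xs h c) = e0K Z xs (dK Z xs 0 c) := by
  induction xs with
  | nil => exact (map_zero (mulT J Z)).trans (map_zero _).symm
  | cons x xs ih =>
    obtain ⟨a, b⟩ : Kos Z xs 1 × Kos Z xs 0 := c
    rw [phiK_cons, dK_cons_zero, map_add, ih, mulT_tmul]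
    change _ = e0K Z xs (_ + _)
    rw [map_add, map_smul]

lemma phiK_d (J : Ideal R) (Z : ModuleCat.{u} R) (xs : List R) (h) (c : Kos Z xs 2) :
    phiK J Z xs h (dK Z xs 1 c) = 0 := by
  induction xs with
  | nil => rfl
  | cons x xs ih =>
    obtain ⟨a, b⟩ : Kos Z xs 2 × Kos Z xs 1 := c
    rw [dK_cons_succ, phiK_cons, map_add, ih, map_smul, map_neg, ← mulT_phiK J Z xs
      (fun y hy => h y (List.mem_cons_of_mem _ hy)), tmul_neg, ← smul_tens]
    simp

lemma phiK_surj (J : Ideal R) (Z : ModuleCat.{u} R) (xs : List R) (h)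
    (hxs : Ideal.span {x | x ∈ xs} = J) : Function.Surjective (phiK J Z xs h) := by
  have key : ∀ x (hx : x ∈ xs) (z : Z), (⟨x, h x hx⟩ : J) ⊗ₜ[R] z ∈
      LinearMap.range (phiK J Z xs h) := by
    clear hxs
    induction xs with
    | nil => intro x hx; simp at hx
    | cons y xs ih =>
      intro x hx z
      rcases List.mem_cons.1 hx with rfl | hx'
      · obtain ⟨b, hb⟩ := (e0K_bij Z xs).2 z
        refine ⟨((0, b) : Kos Z xs 1 × Kos Z xs 0), ?_⟩
        rw [phiK_cons, map_zero, zero_add, hb]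
      · obtain ⟨a, ha⟩ := ih (fun y hy => h y (List.mem_cons_of_mem _ hy)) x hx' z
        refine ⟨((a, 0) : Kos Z xs 1 × Kos Z xs 0), ?_⟩
        rw [phiK_cons, map_zero, tmul_zero, add_zero, ha]
  rw [← LinearMap.range_eq_top, eq_top_iff]
  intro w _
  induction w with
  | zero => exact zero_mem _
  | add a b ha hb => exact add_mem (ha trivial) (hb trivial)
  | tmul j z =>
    obtain ⟨j, hj⟩ := j
    have hj' := hj
    rw [← hxs] at hj'
    induction hj' using Submodule.span_induction with
    | mem x hx => exact key x hx z
    | zero =>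
      have : (⟨0, hj⟩ : J) = 0 := rfl
      rw [this, zero_tmul]; exact zero_mem _
    | add x y hx hy h1 h2 =>
      have hx : x ∈ J := hxs ▸ hx
      have hy : y ∈ J := hxs ▸ hy
      have : (⟨x + y, hj⟩ : J) = ⟨x, hx⟩ + ⟨y, hy⟩ := rfl
      rw [this, add_tmul]
      exact add_mem (h1 hx trivial) (h2 hy trivial)
    | smul r x hx h =>
      have hx : x ∈ J := hxs ▸ hx
      have : (⟨r • x, hj⟩ : J) = r • ⟨x, hx⟩ := rfl
      rw [this, ← smul_tmul']
      exact Submodule.smul_mem _ _ (h hx trivial)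

lemma mulT_surj_of_ExK (J : Ideal R) (Z : ModuleCat.{u} R) (xs : List R)
    (hxs : Ideal.span {x | x ∈ xs} = J) (h0 : ExK Z xs 0) : Function.Surjective (mulT J Z) := by
  intro z
  obtain ⟨c, rfl⟩ := (e0K_bij Z xs).2 z
  obtain ⟨b, rfl⟩ := h0 c trivial
  exact ⟨phiK J Z xs (fun x hx => hxs ▸ Ideal.subset_span hx) b, mulT_phiK _ _ _ _ _⟩

lemma mulT_inj_of_ExK (J : Ideal R) (Z : ModuleCat.{u} R) (xs : List R)
    (hxs : Ideal.span {x | x ∈ xs} = J) (h1 : ExK Z xs 1) : Function.Injective (mulT J Z) := by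
  rw [injective_iff_map_eq_zero]
  intro w hw
  have h : ∀ x ∈ xs, x ∈ J := fun x hx => hxs ▸ Ideal.subset_span hx
  obtain ⟨c, rfl⟩ := phiK_surj J Z xs h hxs w
  rw [mulT_phiK] at hw
  have hc : dK Z xs 0 c = 0 := (e0K_bij Z xs).1 (hw.trans (map_zero _).symm)
  obtain ⟨b, rfl⟩ := h1 c hc
  exact phiK_d _ _ _ _ _

lemma mulT_surj_of_surj (J : Ideal R) {Z Y : Type u} [AddCommGroup Z] [Module R Z]
    [AddCommGroup Y] [Module R Y] (f : Z →ₗ[R] Y) (hf : Function.Surjective f)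
    (h : Function.Surjective (mulT J Z)) : Function.Surjective (mulT J Y) := by
  intro y
  obtain ⟨z, rfl⟩ := hf y
  obtain ⟨w, rfl⟩ := h z
  exact ⟨_, mulT_nat J f w⟩

lemma mulT_inj_quot (J : Ideal R) {M D H : Type u} [AddCommGroup M] [Module R M]
    [AddCommGroup D] [Module R D] [AddCommGroup H] [Module R H] (f : M →ₗ[R] D) (g : D →ₗ[R] H)
    (hg : Function.Surjective g) (hfg : Function.Exact f g)
    (hD : Function.Injective (mulT J D)) (hM : Function.Surjective (mulT J M)) :
    Function.Injective (mulT J H) := by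
  rw [injective_iff_map_eq_zero]
  intro w hw
  obtain ⟨w, rfl⟩ := LinearMap.lTensor_surjective J hg w
  rw [mulT_nat] at hw
  obtain ⟨m, hm⟩ := (hfg _).1 hw
  obtain ⟨v, rfl⟩ := hM m
  rw [← mulT_nat] at hm
  rw [← hD hm, ← LinearMap.comp_apply, ← LinearMap.lTensor_comp, hfg.linearMap_comp_eq_zero]
  simp

lemma quot_tens_zero (J : Ideal R) {Z : Type u} [AddCommGroup Z] [Module R Z] (w : J ⊗[R] Z) :
    (1 : R ⧸ J) ⊗ₜ[R] (mulT J Z w) = 0 := by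
  induction w with
  | zero => simp
  | add a b ha hb => simp only [map_add, tmul_add, ha, hb, add_zero]
  | tmul j z =>
    rw [mulT_tmul, ← smul_tmul]
    have : (j : R) • (1 : R ⧸ J) = 0 := by
      rw [Algebra.smul_def, mul_one]
      exact Ideal.Quotient.eq_zero_iff_mem.2 j.2
    rw [this, zero_tmul]

lemma quot_tens_rep (J : Ideal R) {Z : Type u} [AddCommGroup Z] [Module R Z]
    (w : (R ⧸ J) ⊗[R] Z) : ∃ z : Z, (1 : R ⧸ J) ⊗ₜ[R] z = w := by
  induction w with
  | zero => exact ⟨0, tmul_zero _ _⟩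
  | add a b ha hb =>
    obtain ⟨a, rfl⟩ := ha
    obtain ⟨b, rfl⟩ := hb
    exact ⟨a + b, tmul_add _ _ _⟩
  | tmul j z =>
    obtain ⟨r, rfl⟩ := Ideal.Quotient.mk_surjective j
    refine ⟨r • z, ?_⟩
    rw [← smul_tmul, Algebra.smul_def, mul_one]
    rfl

lemma quot_tens_ker (J : Ideal R) {Z : Type u} [AddCommGroup Z] [Module R Z] (z : Z)
    (h : (1 : R ⧸ J) ⊗ₜ[R] z = 0) : ∃ w, mulT J Z w = z := by
  have h1 : z ∈ J • (⊤ : Submodule R Z) := by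
    have := congrArg (TensorProduct.quotTensorEquivQuotSMul Z J) h
    rw [map_zero] at this
    have h2 : (TensorProduct.quotTensorEquivQuotSMul Z J) ((1 : R ⧸ J) ⊗ₜ[R] z) =
      Submodule.Quotient.mk z := by
      have := TensorProduct.quotTensorEquivQuotSMul_mk_tmul (M := Z) J 1 z
      rwa [map_one, one_smul] at this
    rw [h2] at this
    exact (Submodule.Quotient.mk_eq_zero _).1 this
  clear h
  induction h1 using Submodule.smul_induction_on' with
  | smul r hr n hn => exact ⟨⟨r, hr⟩ ⊗ₜ n, rfl⟩
  | add a _ b _ ha hb =>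
    obtain ⟨a, rfl⟩ := ha
    obtain ⟨b, rfl⟩ := hb
    exact ⟨a + b, map_add _ _ _⟩

lemma tens_exact (J : Ideal R) {P2 P1 P0 H : Type u} [AddCommGroup P2] [Module R P2]
    [AddCommGroup P1] [Module R P1] [AddCommGroup P0] [Module R P0] [AddCommGroup H] [Module R H]
    (d2 : P2 →ₗ[R] P1) (d1 : P1 →ₗ[R] P0) (p : P0 →ₗ[R] H)
    (hp : Function.Surjective p) (e0 : Function.Exact d1 p) (e1 : Function.Exact d2 d1)
    (hH : Function.Injective (mulT J H)) (w : (R ⧸ J) ⊗[R] P1)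
    (hw : d1.lTensor (R ⧸ J) w = 0) : ∃ v, d2.lTensor (R ⧸ J) v = w := by
  obtain ⟨z, rfl⟩ := quot_tens_rep J w
  rw [LinearMap.lTensor_tmul] at hw
  obtain ⟨v, hv⟩ := quot_tens_ker J _ hw
  have h1 : p.lTensor J v = 0 := by
    apply hH
    rw [mulT_nat, hv, map_zero, e0.apply_apply_eq_zero]
  obtain ⟨u, rfl⟩ := (lTensor_exact J e0 hp v).1 h1
  rw [mulT_nat] at hv
  obtain ⟨q, hq⟩ := (e1 (z - mulT J P1 u)).1 (by rw [map_sub, hv, sub_self])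
  refine ⟨1 ⊗ₜ q, ?_⟩
  rw [LinearMap.lTensor_tmul, hq, tmul_sub, quot_tens_zero, sub_zero]

lemma tor_zero (J : Ideal R) (H : ModuleCat.{u} R) (hH : Function.Surjective (mulT J H)) :
    Subsingleton (TorMod R 0 (ModuleCat.of R (R ⧸ J)) H) := by
  have e := (((MonoidalCategory.tensoringLeft (ModuleCat.{u} R)).obj
    (ModuleCat.of R (R ⧸ J))).leftDerivedZeroIsoSelf.app H)
  have : Subsingleton ((R ⧸ J) ⊗[R] H) := by
    refine subsingleton_of_forall_eq 0 fun w => ?_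
    obtain ⟨z, rfl⟩ := quot_tens_rep J w
    obtain ⟨w, rfl⟩ := hH z
    exact quot_tens_zero J w
  exact (e.toLinearEquiv.toEquiv.subsingleton_congr).2 this

lemma tor_one (J : Ideal R) (H : ModuleCat.{u} R) (hH : Function.Injective (mulT J H)) :
    Subsingleton (TorMod R 1 (ModuleCat.of R (R ⧸ J)) H) := by
  let P := projectiveResolution H
  let F := ((MonoidalCategory.tensoringLeft (ModuleCat.{u} R)).obj (ModuleCat.of R (R ⧸ J)))
  have e := P.isoLeftDerivedObj F 1
  have hz : Limits.IsZero (((F.mapHomologicalComplex _).obj P.complex).homology 1) := by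
    rw [← HomologicalComplex.exactAt_iff_isZero_homology,
      HomologicalComplex.exactAt_iff' _ 2 1 0 (by simp) (by simp),
      ShortComplex.moduleCat_exact_iff]
    intro w hw
    have h2 := (ShortComplex.ShortExact.moduleCat_exact_iff_function_exact _).1 (P.exact_succ 0)
    have h1 := (ShortComplex.ShortExact.moduleCat_exact_iff_function_exact _).1 (P.exact₀)
    have h0 : Function.Surjective (P.π.f 0) := (ModuleCat.epi_iff_surjective _).1 inferInstance
    exact tens_exact J (P.complex.d 2 1).hom (P.complex.d 1 0).hom (P.π.f 0).hom h0 h1 h2 hH w hw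
  exact ModuleCat.subsingleton_of_isZero (hz.of_iso e)

end TorPart
section ExtPres
open Opposite HomologicalComplex

theorem cat_paste {𝒞 : Type*} [Category 𝒞] {A B C D A' D' : 𝒞} {a : A ⟶ B} {i : B ⟶ C} {i' : A ⟶ A'}
    {m : A' ⟶ C} {k : C ⟶ D} {k' : A' ⟶ D'} {m' : D' ⟶ D} (h1 : a ≫ i = i' ≫ m)
    (h3 : m ≫ k = k' ≫ m') : a ≫ i ≫ k = (i' ≫ k') ≫ m' := by
  rw [← Category.assoc, h1, Category.assoc, h3, Category.assoc]

theorem cat_sq_inv {𝒞 : Type*} [Category 𝒞] {A B C D : 𝒞} (i : A ≅ B) (j : C ≅ D) {m : B ⟶ D}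
    {n : A ⟶ C} (h : n ≫ j.hom = i.hom ≫ m) : m ≫ j.inv = i.inv ≫ n := by
  rw [Iso.comp_inv_eq, Category.assoc, Iso.eq_inv_comp, h]

variable {R : Type u} [CommRing R]

abbrev Fy (Y : ModuleCat.{u} R) : ModuleCat.{u} R ⥤ (ModuleCat.{u} R)ᵒᵖ :=
  ((linearYoneda R (ModuleCat.{u} R)).obj Y).rightOp

def linMap {P P' : ChainComplex (ModuleCat.{u} R) ℕ} (Φ : P ⟶ P') (Y : ModuleCat.{u} R) :
    P'.linearYonedaObj R Y ⟶ P.linearYonedaObj R Y :=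
  (HomologicalComplex.unopFunctor _ _).map (((Fy Y).mapHomologicalComplex _).map Φ).op

theorem isoExt_nat {X X' : ModuleCat.{u} R} (P : ProjectiveResolution X)
    (P' : ProjectiveResolution X') (φ : X ⟶ X') (Φ : P.complex ⟶ P'.complex)
    (h : Φ.f 0 ≫ P'.π.f 0 = P.π.f 0 ≫ φ) (n : ℕ) (Y : ModuleCat.{u} R) :
    ((Ext R (ModuleCat.{u} R) n).map φ.op).app Y ≫ (P.isoExt n Y).hom =
      (P'.isoExt n Y).hom ≫ homologyMap (linMap Φ Y) n := by
  have h0 := ProjectiveResolution.isoLeftDerivedObj_inv_naturality φ P P' Φ h (Fy Y) n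
  have h2 := HomologicalComplex.homologyOp_hom_naturality (linMap Φ Y) n
  have h1 := congrArg Quiver.Hom.unop h0
  have h3 := congrArg Quiver.Hom.unop h2
  refine cat_paste h1 (cat_sq_inv _ _ ?_)
  exact h3.symm

/-- cocycles -/
def Zc (P : ChainComplex (ModuleCat.{u} R) ℕ) (i : ℕ) (Y : ModuleCat.{u} R) :
    Submodule R (P.X i ⟶ Y) :=
  LinearMap.ker (Linear.leftComp R Y (P.d (i+1) i))

theorem mem_Zc {P : ChainComplex (ModuleCat.{u} R) ℕ} {i : ℕ} {Y : ModuleCat.{u} R}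
    {f : P.X i ⟶ Y} : f ∈ Zc P i Y ↔ P.d (i+1) i ≫ f = 0 := Iff.rfl

theorem exists_pres (P : ChainComplex (ModuleCat.{u} R) ℕ) (i : ℕ) (Y : ModuleCat.{u} R) :
    ∃ π : Zc P (i+1) Y →ₗ[R] (P.linearYonedaObj R Y).homology (i+1), Function.Surjective π ∧
      (∀ f, π f = 0 ↔ ∃ b : P.X i ⟶ Y, f.1 = P.d (i+1) i ≫ b) ∧
      (∀ f : Zc P (i+1) Y, ∃ c, ((P.linearYonedaObj R Y).iCycles (i+1)).hom c = f.1) ∧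
      ∀ f (c : (P.linearYonedaObj R Y).cycles (i+1)),
        ((P.linearYonedaObj R Y).iCycles (i+1)).hom c = f.1 →
        π f = ((P.linearYonedaObj R Y).homologyπ (i+1)).hom c := by
  let Q := P.linearYonedaObj R Y
  have hinj : Function.Injective (Q.iCycles (i+1)).hom :=
    (ModuleCat.mono_iff_injective _).1 inferInstance
  have hsurj : Function.Surjective (Q.homologyπ (i+1)).hom :=
    (ModuleCat.epi_iff_surjective _).1 inferInstance
  have hr : LinearMap.range (Q.iCycles (i+1)).hom = Zc P (i+1) Y := by
    have hex := ShortComplex.exact_of_f_is_kernel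
      (ShortComplex.mk (Q.iCycles (i+1)) (Q.d (i+1) (i+1+1)) (Q.iCycles_d _ _))
      (Q.cyclesIsKernel (i+1) (i+1+1) (by simp))
    have hex2 := (ShortComplex.moduleCat_exact_iff_range_eq_ker _).1 hex
    exact hex2
  let e : Q.cycles (i+1) ≃ₗ[R] Zc P (i+1) Y :=
    (LinearEquiv.ofInjective _ hinj).trans (LinearEquiv.ofEq _ _ hr)
  refine ⟨(Q.homologyπ (i+1)).hom ∘ₗ e.symm.toLinearMap, hsurj.comp e.symm.surjective, ?_, ?_, ?_⟩
  · have hex := ShortComplex.exact_of_g_is_cokernel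
      (ShortComplex.mk (Q.toCycles i (i+1)) (Q.homologyπ (i+1)) (Q.toCycles_comp_homologyπ _ _))
      (Q.homologyIsCokernel i (i+1) (by simp))
    have hex2 := (ShortComplex.moduleCat_exact_iff_range_eq_ker _).1 hex
    have hti : ∀ b, (Q.iCycles (i+1)).hom ((Q.toCycles i (i+1)).hom b) = (Q.d i (i+1)).hom b :=
      fun b => by rw [← Q.toCycles_i i (i+1)]; rfl
    intro f
    obtain ⟨c, rfl⟩ := e.surjective f
    have h1 : ((Q.homologyπ (i+1)).hom ∘ₗ e.symm.toLinearMap) (e c) = (Q.homologyπ (i+1)).hom c := by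
      simp
    have h2 : (Q.homologyπ (i+1)).hom c = 0 ↔ ∃ b, (Q.toCycles i (i+1)).hom b = c := by
      change c ∈ LinearMap.ker (Q.homologyπ (i+1)).hom ↔ _
      exact (SetLike.ext_iff.1 hex2 c).symm
    rw [h1, h2]
    constructor
    · rintro ⟨b, rfl⟩
      exact ⟨b, hti b⟩
    · rintro ⟨b, hb⟩
      exact ⟨b, hinj ((hti b).trans hb.symm)⟩
  · intro f
    obtain ⟨c, rfl⟩ := e.surjective f
    exact ⟨c, rfl⟩
  · intro f c h
    have : e c = f := Subtype.ext h
    subst this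
    simp [Q]


def Zpre {P P' : ChainComplex (ModuleCat.{u} R) ℕ} (Φ : P ⟶ P') (i : ℕ) (Y : ModuleCat.{u} R) :
    Zc P' i Y →ₗ[R] Zc P i Y :=
  LinearMap.restrict (Linear.leftComp R Y (Φ.f i)) (by
    intro f hf
    rw [mem_Zc] at hf
    change P.d (i+1) i ≫ Φ.f i ≫ f = 0
    rw [← Category.assoc, ← Φ.comm, Category.assoc, hf, Limits.comp_zero])

@[simp] theorem Zpre_coe {P P' : ChainComplex (ModuleCat.{u} R) ℕ} (Φ : P ⟶ P') (i : ℕ)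
    (Y : ModuleCat.{u} R) (f : Zc P' i Y) : (Zpre Φ i Y f).1 = Φ.f i ≫ f.1 := rfl

def presE {X : ModuleCat.{u} R} (P : ProjectiveResolution X) (i : ℕ) (Y : ModuleCat.{u} R) :
    Zc P.complex (i+1) Y →ₗ[R] ((Ext R (ModuleCat.{u} R) (i+1)).obj (op X)).obj Y :=
  (P.isoExt (i+1) Y).inv.hom ∘ₗ (exists_pres P.complex i Y).choose

theorem presE_surj {X : ModuleCat.{u} R} (P : ProjectiveResolution X) (i : ℕ)
    (Y : ModuleCat.{u} R) : Function.Surjective (presE P i Y) :=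
  (P.isoExt (i+1) Y).toLinearEquiv.symm.surjective.comp (exists_pres P.complex i Y).choose_spec.1

theorem presE_eq_zero {X : ModuleCat.{u} R} (P : ProjectiveResolution X) (i : ℕ)
    (Y : ModuleCat.{u} R) (f : Zc P.complex (i+1) Y) :
    presE P i Y f = 0 ↔ ∃ b : P.complex.X i ⟶ Y, f.1 = P.complex.d (i+1) i ≫ b := by
  rw [← (exists_pres P.complex i Y).choose_spec.2.1]
  exact (P.isoExt (i+1) Y).toLinearEquiv.symm.map_eq_zero_iff

theorem presE_nat {X X' : ModuleCat.{u} R} (P : ProjectiveResolution X)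
    (P' : ProjectiveResolution X') (φ : X ⟶ X') (Φ : P.complex ⟶ P'.complex)
    (h : Φ.f 0 ≫ P'.π.f 0 = P.π.f 0 ≫ φ) (i : ℕ) (Y : ModuleCat.{u} R)
    (f : Zc P'.complex (i+1) Y) :
    (((Ext R (ModuleCat.{u} R) (i+1)).map φ.op).app Y).hom (presE P' i Y f) =
      presE P i Y (Zpre Φ (i+1) Y f) := by
  have h1 := cat_sq_inv (P'.isoExt (i+1) Y) (P.isoExt (i+1) Y) (isoExt_nat P P' φ Φ h (i+1) Y)
  obtain ⟨c, hc⟩ := (exists_pres P'.complex i Y).choose_spec.2.2.1 f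
  have h2 := (exists_pres P'.complex i Y).choose_spec.2.2.2 f c hc
  have h3 := (exists_pres P.complex i Y).choose_spec.2.2.2 (Zpre Φ (i+1) Y f)
    ((cyclesMap (linMap Φ Y) (i+1)).hom c) (by
      have := ConcreteCategory.congr_hom (cyclesMap_i (linMap Φ Y) (i+1)) c
      refine this.trans ?_
      change ((linMap Φ Y).f (i+1)).hom
        (((P'.complex.linearYonedaObj R Y).iCycles (i+1)).hom c) = _
      rw [hc]; rfl)
  have h4 := ConcreteCategory.congr_hom (homologyπ_naturality (linMap Φ Y) (i+1)) c
  have h5 := ConcreteCategory.congr_hom h1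
    (((P'.complex.linearYonedaObj R Y).homologyπ (i+1)).hom c)
  change (((Ext R (ModuleCat.{u} R) (i+1)).map φ.op).app Y).hom ((P'.isoExt (i+1) Y).inv.hom
    ((exists_pres P'.complex i Y).choose f)) = (P.isoExt (i+1) Y).inv.hom
    ((exists_pres P.complex i Y).choose _)
  rw [h2, h3]
  refine h5.symm.trans ?_
  exact congrArg (P.isoExt (i+1) Y).inv.hom h4

end ExtPres
section Shift
open Opposite HomologicalComplex

variable {R : Type u} [CommRing R] (S : ShortComplex (ModuleCat.{u} R))

def TT (P : ChainComplex (ModuleCat.{u} R) ℕ) (j : ℕ) :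
    Submodule R ((P.X j ⟶ S.X₂) × (P.X (j+1) ⟶ S.X₁)) :=
  LinearMap.ker ((Linear.leftComp R S.X₂ (P.d (j+1) j)) ∘ₗ LinearMap.fst R _ _ -
    (Linear.rightComp R (P.X (j+1)) S.f) ∘ₗ LinearMap.snd R _ _)

variable {S} in
theorem mem_TT {P : ChainComplex (ModuleCat.{u} R) ℕ} {j : ℕ}
    {t : (P.X j ⟶ S.X₂) × (P.X (j+1) ⟶ S.X₁)} :
    t ∈ TT S P j ↔ P.d (j+1) j ≫ t.1 = t.2 ≫ S.f := by
  rw [← sub_eq_zero]; rfl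

def TC (P : ChainComplex (ModuleCat.{u} R) ℕ) (j : ℕ) : TT S P j →ₗ[R] Zc P j S.X₃ :=
  LinearMap.codRestrict _ ((Linear.rightComp R (P.X j) S.g) ∘ₗ LinearMap.fst R _ _ ∘ₗ
    (TT S P j).subtype) (by
    rintro ⟨t, ht⟩
    rw [mem_TT] at ht
    rw [mem_Zc]
    change P.d (j+1) j ≫ t.1 ≫ S.g = 0
    rw [← Category.assoc, ht, Category.assoc, S.zero, Limits.comp_zero])

@[simp] theorem TC_coe (P : ChainComplex (ModuleCat.{u} R) ℕ) (j : ℕ) (t : TT S P j) :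
    (TC S P j t).1 = t.1.1 ≫ S.g := rfl

variable {S} in
def TA (hS : S.ShortExact) (P : ChainComplex (ModuleCat.{u} R) ℕ) (j : ℕ) :
    TT S P j →ₗ[R] Zc P (j+1) S.X₁ :=
  LinearMap.codRestrict _ (LinearMap.snd R _ _ ∘ₗ (TT S P j).subtype) (by
    rintro ⟨t, ht⟩
    rw [mem_TT] at ht
    rw [mem_Zc]
    change P.d (j+2) (j+1) ≫ t.2 = 0
    have := hS.mono_f
    rw [← cancel_mono S.f, Category.assoc, ← ht]
    simp)

@[simp] theorem TA_coe (hS : S.ShortExact) (P : ChainComplex (ModuleCat.{u} R) ℕ) (j : ℕ)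
    (t : TT S P j) : (TA hS P j t).1 = t.1.2 := rfl

def TTpre {P P' : ChainComplex (ModuleCat.{u} R) ℕ} (Φ : P ⟶ P') (j : ℕ) (t : TT S P' j) :
    TT S P j :=
  ⟨(Φ.f j ≫ t.1.1, Φ.f (j+1) ≫ t.1.2), by
    have := mem_TT.1 t.2
    rw [mem_TT]
    simp only [Category.assoc]
    rw [← this]
    simp⟩

variable {S}

theorem exists_lift_f (hS : S.ShortExact) {X : ModuleCat.{u} R} (g : X ⟶ S.X₂) (h : g ≫ S.g = 0) :
    ∃ a : X ⟶ S.X₁, a ≫ S.f = g := by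
  have := hS.mono_f
  exact ⟨hS.exact.lift g h, hS.exact.lift_f g h⟩

theorem exists_lift_g (hS : S.ShortExact) {X : ModuleCat.{u} R} [Projective X] (g : X ⟶ S.X₃) :
    ∃ a : X ⟶ S.X₂, a ≫ S.g = g := by
  have := hS.epi_g
  exact ⟨Projective.factorThru g S.g, Projective.factorThru_comp g S.g⟩

theorem exists_ext {X : ModuleCat.{u} R} (P : ProjectiveResolution X) {E : ModuleCat.{u} R}
    [Injective E] (j : ℕ) (g : P.complex.X (j+1) ⟶ E) (h : P.complex.d (j+2) (j+1) ≫ g = 0) :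
    ∃ c : P.complex.X j ⟶ E, g = P.complex.d (j+1) j ≫ c :=
  ⟨(P.exact_succ j).descToInjective g h, ((P.exact_succ j).comp_descToInjective g h).symm⟩

theorem exists_snd (hS : S.ShortExact) {P : ChainComplex (ModuleCat.{u} R) ℕ} (j : ℕ)
    (c : P.X j ⟶ S.X₂) (h : P.d (j+1) j ≫ c ≫ S.g = 0) : ∃ t : TT S P j, t.1.1 = c := by
  obtain ⟨a, ha⟩ := exists_lift_f hS (P.d (j+1) j ≫ c) (by simpa using h)
  exact ⟨⟨(c, a), mem_TT.2 ha.symm⟩, rfl⟩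

theorem TC_surj (hS : S.ShortExact) {X : ModuleCat.{u} R} (P : ProjectiveResolution X) (j : ℕ) :
    Function.Surjective (TC S P.complex j) := by
  rintro ⟨z, hz⟩
  obtain ⟨c, rfl⟩ := exists_lift_g hS z
  obtain ⟨t, rfl⟩ := exists_snd hS j c hz
  exact ⟨t, rfl⟩

theorem TA_surj (hS : S.ShortExact) [Injective S.X₂] {X : ModuleCat.{u} R}
    (P : ProjectiveResolution X) (j : ℕ) :
    Function.Surjective (TA hS P.complex j) := by
  rintro ⟨a, ha⟩
  rw [mem_Zc] at ha
  obtain ⟨c, hc⟩ := exists_ext P j (a ≫ S.f) (by rw [← Category.assoc, ha, Limits.zero_comp])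
  exact ⟨⟨(c, a), mem_TT.2 hc.symm⟩, rfl⟩

theorem eqv_of_ker {T M N : Type*} [AddCommGroup T] [Module R T] [AddCommGroup M] [Module R M]
    [AddCommGroup N] [Module R N] (q1 : T →ₗ[R] M) (q2 : T →ₗ[R] N) (h1 : Function.Surjective q1)
    (h2 : Function.Surjective q2) (h : ∀ t, q1 t = 0 ↔ q2 t = 0) :
    ∃ e : M ≃ₗ[R] N, ∀ t, e (q1 t) = q2 t := by
  have hk : LinearMap.ker q1 = LinearMap.ker q2 := by ext t; exact h t
  refine ⟨(q1.quotKerEquivOfSurjective h1).symm.trans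
    ((Submodule.quotEquivOfEq _ _ hk).trans (q2.quotKerEquivOfSurjective h2)), fun t => ?_⟩
  have : (q1.quotKerEquivOfSurjective h1).symm (q1 t) = Submodule.Quotient.mk t := by
    rw [LinearEquiv.symm_apply_eq]; rfl
  simp [this]

theorem ext_shift (hS : S.ShortExact) [Injective S.X₂] {X : ModuleCat.{u} R}
    (P : ProjectiveResolution X) (i : ℕ) :
    ∃ e : ((Ext R (ModuleCat.{u} R) (i+1)).obj (op X)).obj S.X₃ ≃ₗ[R]
      ((Ext R (ModuleCat.{u} R) (i+2)).obj (op X)).obj S.X₁,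
      ∀ t, e (presE P i S.X₃ (TC S P.complex (i+1) t)) =
        presE P (i+1) S.X₁ (TA hS P.complex (i+1) t) := by
  have hm := hS.mono_f
  refine eqv_of_ker (presE P i S.X₃ ∘ₗ TC S P.complex (i+1))
    (presE P (i+1) S.X₁ ∘ₗ TA hS P.complex (i+1)) ((presE_surj _ _ _).comp (TC_surj hS _ _))
    ((presE_surj _ _ _).comp (TA_surj hS _ _)) ?_
  rintro ⟨⟨c, a⟩, hca⟩
  simp only [LinearMap.comp_apply, presE_eq_zero, TC_coe, TA_coe]
  rw [mem_TT] at hca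
  simp only at hca
  constructor
  · rintro ⟨b, hb⟩
    obtain ⟨b', rfl⟩ := exists_lift_g hS b
    obtain ⟨a', ha'⟩ := exists_lift_f hS (c - P.complex.d (i+1) i ≫ b') (by simp [hb])
    refine ⟨a', ?_⟩
    rw [← cancel_mono S.f, ← hca, Category.assoc, ha']
    simp
  · rintro ⟨b, hb⟩
    obtain ⟨c', hc'⟩ := exists_ext P i (c - b ≫ S.f) (by
      rw [Preadditive.comp_sub, hca, hb, Category.assoc, sub_self])
    refine ⟨c' ≫ S.g, ?_⟩
    rw [← Category.assoc, ← hc']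
    simp

/-- the diagram -/
abbrev DG (I : Ideal R) (i : ℕ) (M : ModuleCat.{u} R) : ℕᵒᵖᵒᵖ ⥤ ModuleCat.{u} R :=
  localCohomology.diagram (localCohomology.idealPowersDiagram I) i ⋙ (evaluation _ _).obj M

theorem exists_LC_colim (I : Ideal R) (i : ℕ) (M : ModuleCat.{u} R) :
    ∃ c : Limits.Cocone (DG I i M), Nonempty (Limits.IsColimit c) ∧ c.pt = LC R I i M := by
  have := localCohomology.hasColimitDiagram.{u, 0} (localCohomology.idealPowersDiagram I) i
  exact ⟨_, ⟨Limits.isColimitOfPreserves ((evaluation _ _).obj M)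
    (Limits.colimit.isColimit
      (localCohomology.diagram (localCohomology.idealPowersDiagram I) i))⟩, rfl⟩

abbrev LCc (I : Ideal R) (i : ℕ) (M : ModuleCat.{u} R) : Limits.Cocone (DG I i M) :=
  (exists_LC_colim I i M).choose

def LCcol (I : Ideal R) (i : ℕ) (M : ModuleCat.{u} R) : Limits.IsColimit (LCc I i M) :=
  (exists_LC_colim I i M).choose_spec.1.some

theorem LCc_pt (I : Ideal R) (i : ℕ) (M : ModuleCat.{u} R) : (LCc I i M).pt = LC R I i M :=
  (exists_LC_colim I i M).choose_spec.2

theorem DG_nat (hS : S.ShortExact) [Injective S.X₂] (I : Ideal R) (i : ℕ) :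
    Nonempty (DG I (i+1) S.X₃ ≅ DG I (i+2) S.X₁) := by
  have key := fun n : ℕᵒᵖᵒᵖ => ext_shift hS (projectiveResolution
    ((localCohomology.ringModIdeals (localCohomology.idealPowersDiagram I)).obj n.unop)) i
  choose e he using key
  refine ⟨NatIso.ofComponents (fun n => (e n).toModuleIso) ?_⟩
  intro n m w
  ext x
  obtain ⟨t, rfl⟩ := ((presE_surj (projectiveResolution
    ((localCohomology.ringModIdeals (localCohomology.idealPowersDiagram I)).obj n.unop)) i S.X₃).comp
      (TC_surj hS _ _)) x
  have hlift := ProjectiveResolution.lift_commutes_zero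
    ((localCohomology.ringModIdeals (localCohomology.idealPowersDiagram I)).map w.unop)
    (projectiveResolution
    ((localCohomology.ringModIdeals (localCohomology.idealPowersDiagram I)).obj m.unop))
    (projectiveResolution
    ((localCohomology.ringModIdeals (localCohomology.idealPowersDiagram I)).obj n.unop))
  have n1 := presE_nat _ _ _ _ hlift i S.X₃ (TC S _ (i+1) t)
  have n2 := presE_nat _ _ _ _ hlift (i+1) S.X₁ (TA hS _ (i+1) t)
  have e1 := he n t
  have e2 := he m (TTpre S (ProjectiveResolution.lift
    ((localCohomology.ringModIdeals (localCohomology.idealPowersDiagram I)).map w.unop) _ _) _ t)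
  change e m ((((Ext R (ModuleCat.{u} R) (i+1)).map _).app S.X₃).hom _) =
    (((Ext R (ModuleCat.{u} R) (i+2)).map _).app S.X₁).hom (e n _)
  refine (congrArg (e m) n1).trans ?_
  refine Eq.trans ?_ ((congrArg _ e1).trans n2).symm
  refine Eq.trans ?_ e2
  congr 2

theorem LC_shift (hS : S.ShortExact) [Injective S.X₂] (I : Ideal R) (i : ℕ) :
    Nonempty (LC R I (i+1) S.X₃ ≃ₗ[R] LC R I (i+2) S.X₁) := by
  rw [← LCc_pt, ← LCc_pt]
  obtain ⟨α⟩ := DG_nat hS I i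
  exact ⟨(Limits.IsColimit.coconePointsIsoOfNatIso (LCcol I (i+1) S.X₃) (LCcol I (i+2) S.X₁)
    α).toLinearEquiv⟩

end Shift
section LCone
open Opposite HomologicalComplex

variable {R : Type u} [CommRing R] {S : ShortComplex (ModuleCat.{u} R)}

def epsP {X : ModuleCat.{u} R} (P : ProjectiveResolution X) : P.complex.X 0 →ₗ[R] X :=
  (P.π.f 0).hom

theorem epsP_surj {X : ModuleCat.{u} R} (P : ProjectiveResolution X) :
    Function.Surjective (epsP P) :=
  (ModuleCat.epi_iff_surjective (P.π.f 0)).1 inferInstance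

theorem epsP_ker {X : ModuleCat.{u} R} (P : ProjectiveResolution X) (y : P.complex.X 0) :
    epsP P y = 0 ↔ ∃ w, (P.complex.d 1 0).hom w = y := by
  have := (ShortComplex.moduleCat_exact_iff_range_eq_ker _).1 P.exact₀
  exact (SetLike.ext_iff.1 this y).symm

theorem epsP_nat {X X' : ModuleCat.{u} R} (P : ProjectiveResolution X)
    (P' : ProjectiveResolution X') (φ : X ⟶ X') (Φ : P.complex ⟶ P'.complex)
    (h : Φ.f 0 ≫ P'.π.f 0 = P.π.f 0 ≫ φ) (x : P.complex.X 0) :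
    epsP P' ((Φ.f 0).hom x) = φ.hom (epsP P x) :=
  ConcreteCategory.congr_hom h x

theorem Zc_zero_indep {X : ModuleCat.{u} R} (P : ProjectiveResolution X) {C : ModuleCat.{u} R}
    (z : P.complex.X 0 ⟶ C) (hz : P.complex.d 1 0 ≫ z = 0) (x y : P.complex.X 0)
    (h : epsP P x = epsP P y) : z.hom x = z.hom y := by
  obtain ⟨w, hw⟩ := (epsP_ker P (x - y)).1 (by rw [map_sub, h, sub_self])
  have : z.hom ((P.complex.d 1 0).hom w) = 0 := ConcreteCategory.congr_hom hz w
  rw [hw, map_sub, sub_eq_zero] at this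
  exact this

variable {𝔞 : Ideal R} (P : ProjectiveResolution (ModuleCat.of R (R ⧸ 𝔞)))

theorem Zc_zero_ext {C : ModuleCat.{u} R}
    (z z' : P.complex.X 0 ⟶ C) (hz : P.complex.d 1 0 ≫ z = 0) (hz' : P.complex.d 1 0 ≫ z' = 0)
    (x : P.complex.X 0) (hx : epsP P x = (1 : R ⧸ 𝔞)) (h : z.hom x = z'.hom x) : z = z' := by
  ext y
  obtain ⟨r, hr⟩ := Ideal.Quotient.mk_surjective (epsP P y : R ⧸ 𝔞)
  have h1 : epsP P y = epsP P (r • x) := by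
    rw [map_smul, hx, ← hr]
    change _ = r • (1 : R ⧸ 𝔞)
    rw [Algebra.smul_def, mul_one]
    rfl
  have e1 := Zc_zero_indep P z hz _ _ h1
  have e2 := Zc_zero_indep P z' hz' _ _ h1
  rw [map_smul] at e1 e2
  exact e1.trans ((congrArg (r • ·) h).trans e2.symm)

theorem Zc_zero_tors {C : ModuleCat.{u} R}
    (z : P.complex.X 0 ⟶ C) (hz : P.complex.d 1 0 ≫ z = 0)
    (x : P.complex.X 0) (hx : epsP P x = (1 : R ⧸ 𝔞)) (a : R) (ha : a ∈ 𝔞) : a • z.hom x = 0 := by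
  have h1 : epsP P (a • x) = epsP P 0 := by
    rw [map_smul, hx, map_zero]
    change a • (1 : R ⧸ 𝔞) = 0
    rw [Algebra.smul_def, mul_one]
    exact Ideal.Quotient.eq_zero_iff_mem.2 ha
  have e1 := Zc_zero_indep P z hz _ _ h1
  rwa [map_smul, map_zero] at e1

theorem exists_Zc_zero {C : ModuleCat.{u} R} (e : C) (he : ∀ a ∈ 𝔞, a • e = 0) :
    ∃ z : P.complex.X 0 ⟶ C, P.complex.d 1 0 ≫ z = 0 ∧
      ∀ x : P.complex.X 0, epsP P x = (1 : R ⧸ 𝔞) → z.hom x = e := by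
  let l : (R ⧸ 𝔞) →ₗ[R] C := Submodule.liftQ 𝔞 (LinearMap.toSpanSingleton R C e) (by
    intro a ha
    exact he a ha)
  refine ⟨ModuleCat.ofHom (l ∘ₗ epsP P), ?_, ?_⟩
  · ext w
    change l (epsP P ((P.complex.d 1 0).hom w)) = 0
    rw [(epsP_ker P _).2 ⟨w, rfl⟩]
    exact map_zero l
  · intro x hx
    change l (epsP P x) = e
    rw [hx]
    change l (Submodule.Quotient.mk 1) = e
    exact one_smul R e

theorem exists_lift_surj {T M N : Type*} [AddCommGroup T] [Module R T] [AddCommGroup M] [Module R M]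
    [AddCommGroup N] [Module R N] (q : T →ₗ[R] M) (g : T →ₗ[R] N) (h1 : Function.Surjective q)
    (h : ∀ t, q t = 0 → g t = 0) : ∃ e : M →ₗ[R] N, ∀ t, e (q t) = g t := by
  refine ⟨(Submodule.liftQ (LinearMap.ker q) g h) ∘ₗ
    (q.quotKerEquivOfSurjective h1).symm.toLinearMap, fun t => ?_⟩
  have : (q.quotKerEquivOfSurjective h1).symm (q t) = Submodule.Quotient.mk t := by
    rw [LinearEquiv.symm_apply_eq]; rfl
  rw [LinearMap.comp_apply, LinearEquiv.coe_coe, this]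
  rfl

/-- image of the torsion of the middle term, inside the torsion of the quotient -/
def NN (I : Ideal R) (S : ShortComplex (ModuleCat.{u} R)) : Submodule R (gam I S.X₃) :=
  Submodule.comap (gam I S.X₃).subtype (Submodule.map S.g.hom (gam I S.X₂))

theorem mem_NN {I : Ideal R} {c : gam I S.X₃} :
    c ∈ NN I S ↔ ∃ e ∈ gam I S.X₂, S.g.hom e = c.1 := Iff.rfl

theorem TT_tors (I : Ideal R) (k : ℕ) (P : ProjectiveResolution (ModuleCat.of R (R ⧸ I ^ k)))
    (t : TT S P.complex 0) (x : P.complex.X 0) (hx : epsP P x = (1 : R ⧸ I ^ k)) :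
    S.g.hom (t.1.1.hom x) ∈ gam I S.X₃ :=
  mem_gam.2 ⟨k, Zc_zero_tors P (TC S P.complex 0 t).1 (mem_Zc.1 (TC S P.complex 0 t).2) x hx⟩

theorem exists_psi (hS : S.ShortExact) [Injective S.X₂] (I : Ideal R) (k : ℕ)
    (P : ProjectiveResolution (ModuleCat.of R (R ⧸ I ^ k))) :
    ∃ ψ : ((Ext R (ModuleCat.{u} R) 1).obj (op (ModuleCat.of R (R ⧸ I ^ k)))).obj S.X₁ →ₗ[R]
      (gam I S.X₃ ⧸ NN I S), ∀ (t : TT S P.complex 0) (x : P.complex.X 0)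
        (hx : epsP P x = (1 : R ⧸ I ^ k)), ψ (presE P 0 S.X₁ (TA hS P.complex 0 t)) =
        Submodule.Quotient.mk ⟨S.g.hom (t.1.1.hom x), TT_tors I k P t x hx⟩ := by
  obtain ⟨x0, hx0⟩ := epsP_surj P (1 : R ⧸ I ^ k)
  let g0 : TT S P.complex 0 →ₗ[R] gam I S.X₃ :=
    { toFun := fun t => ⟨S.g.hom (t.1.1.hom x0), TT_tors I k P t x0 hx0⟩
      map_add' := fun t t' => Subtype.ext (map_add S.g.hom _ _)
      map_smul' := fun r t => Subtype.ext (map_smul S.g.hom _ _) }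
  obtain ⟨ψ, hψ⟩ := exists_lift_surj (presE P 0 S.X₁ ∘ₗ TA hS P.complex 0) ((NN I S).mkQ ∘ₗ g0)
    ((presE_surj _ _ _).comp (TA_surj hS _ _)) (by
      rintro ⟨⟨c, a⟩, hca⟩ h
      rw [LinearMap.comp_apply, presE_eq_zero] at h
      obtain ⟨b, hb⟩ := h
      simp only [TA_coe] at hb
      rw [mem_TT] at hca
      simp only at hca
      rw [LinearMap.comp_apply, Submodule.mkQ_apply, Submodule.Quotient.mk_eq_zero, mem_NN]
      refine ⟨(c - b ≫ S.f).hom x0, mem_gam.2 ⟨k, Zc_zero_tors P _ ?_ x0 hx0⟩, ?_⟩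
      · rw [Preadditive.comp_sub, hca, hb, Category.assoc, sub_self]
      · have : (c - b ≫ S.f) ≫ S.g = c ≫ S.g := by simp
        exact ConcreteCategory.congr_hom this x0)
  refine ⟨ψ, fun t x hx => (hψ t).trans ?_⟩
  have e1 := Zc_zero_indep P _ (mem_Zc.1 (TC S P.complex 0 t).2) x0 x (hx0.trans hx.symm)
  exact congrArg Submodule.Quotient.mk (Subtype.ext e1)


theorem LC_one (hS : S.ShortExact) [Injective S.X₂] (I : Ideal R) :
    Nonempty (LC R I 1 S.X₁ ≃ₗ[R] (gam I S.X₃ ⧸ NN I S)) := by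
  rw [← LCc_pt]
  let P := fun n : ℕᵒᵖᵒᵖ => projectiveResolution (ModuleCat.of R (R ⧸ I ^ n.unop.unop))
  have key := fun n : ℕᵒᵖᵒᵖ => exists_psi hS I n.unop.unop (P n)
  choose ψ hψ using key
  -- transition maps
  have trans : ∀ (n m : ℕᵒᵖᵒᵖ) (w : n ⟶ m) (t : TT S (P n).complex 0),
      ∃ (Φ : (P m).complex ⟶ (P n).complex), (∀ x, epsP (P m) x = (1 : R ⧸ I ^ m.unop.unop) →
        epsP (P n) ((Φ.f 0).hom x) = (1 : R ⧸ I ^ n.unop.unop)) ∧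
      ((DG I 1 S.X₁).map w).hom (presE (P n) 0 S.X₁ (TA hS (P n).complex 0 t)) =
        presE (P m) 0 S.X₁ (TA hS (P m).complex 0 (TTpre S Φ 0 t)) := by
    intro n m w t
    have hlift := ProjectiveResolution.lift_commutes_zero
      ((localCohomology.ringModIdeals (localCohomology.idealPowersDiagram I)).map w.unop)
      (P m) (P n)
    refine ⟨_, ?_, presE_nat _ _ _ _ hlift 0 S.X₁ (TA hS _ 0 t)⟩
    intro x hx
    exact (epsP_nat _ _ _ _ hlift x).trans (congrArg _ hx)
  have rep : ∀ n (y : (DG I 1 S.X₁).obj n), ∃ t : TT S (P n).complex 0,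
      presE (P n) 0 S.X₁ (TA hS (P n).complex 0 t) = y := fun n y =>
    ((presE_surj (P n) 0 S.X₁).comp (TA_surj hS (P n) 0)) y
  let cc : Limits.Cocone (DG I 1 S.X₁) :=
    { pt := ModuleCat.of R (gam I S.X₃ ⧸ NN I S)
      ι := { app := fun n => ModuleCat.ofHom (ψ n)
             naturality := by
              intro n m w
              ext y
              obtain ⟨t, rfl⟩ := rep n y
              obtain ⟨Φ, h1, h2⟩ := trans n m w t
              obtain ⟨x, hx⟩ := epsP_surj (P m) (1 : R ⧸ I ^ m.unop.unop)
              change ψ m (((DG I 1 S.X₁).map w).hom _) = ψ n _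
              rw [h2, hψ m _ x hx, hψ n t _ (h1 x hx)]
              rfl } }
  let D : (LCc I 1 S.X₁).pt ⟶ ModuleCat.of R (gam I S.X₃ ⧸ NN I S) := (LCcol I 1 S.X₁).desc cc
  have hD : ∀ n (y : (DG I 1 S.X₁).obj n), D.hom (((LCc I 1 S.X₁).ι.app n).hom y) = ψ n y :=
    fun n y => ConcreteCategory.congr_hom ((LCcol I 1 S.X₁).fac cc n) y
  refine ⟨LinearEquiv.ofBijective D.hom ⟨?_, ?_⟩⟩
  · rw [injective_iff_map_eq_zero]
    intro z hz
    have := (IsFiltered.of_equivalence (opOpEquivalence ℕ).symm : IsFiltered ℕᵒᵖᵒᵖ)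
    have := Limits.preservesFilteredColimitsOfSize_shrink.{0, u, 0, u}
      (CategoryTheory.forget (ModuleCat.{u} R))
    obtain ⟨n, y, rfl⟩ := Limits.Concrete.isColimit_exists_rep _ (LCcol I 1 S.X₁) z
    obtain ⟨t, rfl⟩ := rep n y
    obtain ⟨x0, hx0⟩ := epsP_surj (P n) (1 : R ⧸ I ^ n.unop.unop)
    have hz' := (hD n _).symm.trans hz
    rw [hψ n t x0 hx0, Submodule.Quotient.mk_eq_zero, mem_NN] at hz'
    obtain ⟨e, he, hge⟩ := hz'
    obtain ⟨k, hk⟩ := mem_gam.1 he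
    let m : ℕᵒᵖᵒᵖ := op (op (max n.unop.unop k))
    let w : n ⟶ m := (homOfLE (le_max_left n.unop.unop k)).op.op
    obtain ⟨Φ, h1, h2⟩ := trans n m w t
    obtain ⟨x, hx⟩ := epsP_surj (P m) (1 : R ⧸ I ^ m.unop.unop)
    have hw := ConcreteCategory.congr_hom ((LCc I 1 S.X₁).w w)
      (presE (P n) 0 S.X₁ (TA hS (P n).complex 0 t))
    refine hw.symm.trans ?_
    change ((LCc I 1 S.X₁).ι.app m).hom (((DG I 1 S.X₁).map w).hom _) = 0
    rw [h2]
    suffices hs : presE (P m) 0 S.X₁ (TA hS (P m).complex 0 (TTpre S Φ 0 t)) = 0 by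
      rw [hs]; exact map_zero _
    obtain ⟨z, hz0, hz1⟩ := exists_Zc_zero (P m) e
      (fun a ha => hk a (Ideal.pow_le_pow_right (le_max_right n.unop.unop k) ha))
    have hcz : (TTpre S Φ 0 t).1.1 ≫ S.g = z ≫ S.g := by
      refine Zc_zero_ext (P m) _ _ (mem_Zc.1 (TC S (P m).complex 0 (TTpre S Φ 0 t)).2)
        (by rw [← Category.assoc, hz0, Limits.zero_comp]) x hx ?_
      have e1 := Zc_zero_indep (P n) _ (mem_Zc.1 (TC S (P n).complex 0 t).2) x0 ((Φ.f 0).hom x)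
        (hx0.trans (h1 x hx).symm)
      change S.g.hom (t.1.1.hom ((Φ.f 0).hom x)) = S.g.hom (z.hom x)
      rw [hz1 x hx, hge]
      exact e1.symm
    obtain ⟨b, hb⟩ := exists_lift_f hS ((TTpre S Φ 0 t).1.1 - z) (by
      rw [Preadditive.sub_comp, hcz, sub_self])
    rw [presE_eq_zero]
    refine ⟨b, ?_⟩
    have hm := hS.mono_f
    rw [TA_coe, ← cancel_mono S.f, ← mem_TT.1 (TTpre S Φ 0 t).2, Category.assoc, hb,
      Preadditive.comp_sub, hz0, sub_zero]
  · intro q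
    obtain ⟨⟨c, hc⟩, rfl⟩ := Submodule.Quotient.mk_surjective _ q
    obtain ⟨k, hk⟩ := mem_gam.1 hc
    let m : ℕᵒᵖᵒᵖ := op (op k)
    obtain ⟨x, hx⟩ := epsP_surj (P m) (1 : R ⧸ I ^ m.unop.unop)
    obtain ⟨z, hz0, hz1⟩ := exists_Zc_zero (P m) c hk
    obtain ⟨t, ht⟩ := TC_surj hS (P m) 0 ⟨z, hz0⟩
    refine ⟨((LCc I 1 S.X₁).ι.app m).hom (presE (P m) 0 S.X₁ (TA hS (P m).complex 0 t)), ?_⟩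
    refine (hD m _).trans ((hψ m t x hx).trans ?_)
    refine congrArg Submodule.Quotient.mk (Subtype.ext ?_)
    refine Eq.trans ?_ (hz1 x hx)
    exact ConcreteCategory.congr_hom (congrArg Subtype.val ht) x

end LCone
section Final
open Opposite

variable {R : Type u} [CommRing R]

def nextK (K : ModuleCat.{u} R) : ModuleCat.{u} R := Limits.cokernel (Injective.ι K)

def nextS (K : ModuleCat.{u} R) : ShortComplex (ModuleCat.{u} R) :=
  ShortComplex.mk (X₁ := K) (X₂ := Injective.under K) (X₃ := nextK K) (Injective.ι K)
    (Limits.cokernel.π (Injective.ι K)) (Limits.cokernel.condition _)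

theorem nextS_exact (K : ModuleCat.{u} R) : (nextS K).ShortExact where
  exact := ShortComplex.exact_cokernel _
  mono_f := inferInstanceAs (Mono (Injective.ι K))
  epi_g := inferInstanceAs (Epi (Limits.cokernel.π (Injective.ι K)))

instance (K : ModuleCat.{u} R) : Injective (nextS K).X₂ :=
  inferInstanceAs (Injective (Injective.under K))

def Kc (K : ModuleCat.{u} R) : ℕ → ModuleCat.{u} R
  | 0 => K
  | (j+1) => nextK (Kc K j)

theorem LC_iter (I : Ideal R) (K : ModuleCat.{u} R) (j i : ℕ) :
    Nonempty (LC R I (i+1) (Kc K j) ≃ₗ[R] LC R I (i+j+1) K) := by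
  induction j generalizing i with
  | zero => exact ⟨LinearEquiv.refl _ _⟩
  | succ j ih =>
    obtain ⟨e⟩ := LC_shift (nextS_exact (Kc K j)) I i
    obtain ⟨e'⟩ := ih (i+1)
    have h : i + 1 + j + 1 = i + (j + 1) + 1 := by omega
    rw [h] at e'
    exact ⟨e.trans e'⟩

/-- quotient by torsion -/
abbrev barM (I : Ideal R) (M : ModuleCat.{u} R) : ModuleCat.{u} R := ModuleCat.of R (M ⧸ gam I M)

def barMap (I : Ideal R) {M N : ModuleCat.{u} R} (f : M ⟶ N) : barM I M →ₗ[R] barM I N :=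
  Submodule.mapQ _ _ f.hom (fun _ hm => gam_map f.hom hm)

theorem barMap_mk (I : Ideal R) {M N : ModuleCat.{u} R} (f : M ⟶ N) (m : M) :
    barMap I f (Submodule.Quotient.mk m) = Submodule.Quotient.mk (f.hom m) := rfl

theorem barMap_surj (I : Ideal R) {M N : ModuleCat.{u} R} (f : M ⟶ N)
    (hf : Function.Surjective f.hom) : Function.Surjective (barMap I f) := by
  intro y
  obtain ⟨y, rfl⟩ := Submodule.Quotient.mk_surjective _ y
  obtain ⟨x, rfl⟩ := hf y
  exact ⟨Submodule.Quotient.mk x, rfl⟩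

theorem bar_ExK [IsNoetherianRing R] (I J : Ideal R) (hIJ : I ≤ J) (xs : List R)
    (hxs : Ideal.span {x | x ∈ xs} = J) (E : ModuleCat.{u} R) [hE : Injective E] (i : ℕ) :
    ExK (barM I E) xs i := by
  have h1 : Module.Injective R E :=
    @Module.injective_module_of_injective_object R E _ _ _ hE
  exact ExK_of_injective xs (barM I E) (quot_injective _ (gam_injective I h1) h1)
    (TF_of_gam I J hIJ xs hxs (gam_quot I)) i

variable {S : ShortComplex (ModuleCat.{u} R)}

theorem se_inj (hS : S.ShortExact) : Function.Injective S.f.hom :=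
  (ModuleCat.mono_iff_injective _).1 hS.mono_f

theorem se_surj (hS : S.ShortExact) : Function.Surjective S.g.hom :=
  (ModuleCat.epi_iff_surjective _).1 hS.epi_g

theorem se_ex (hS : S.ShortExact) (x : S.X₂) (h : S.g.hom x = 0) : ∃ y, S.f.hom y = x :=
  ((ShortComplex.moduleCat_exact_iff _).1 hS.exact) x h

theorem se_zero (y : S.X₁) : S.g.hom (S.f.hom y) = 0 :=
  ConcreteCategory.congr_hom S.zero y

theorem bar_exact (hS : S.ShortExact) (I : Ideal R)
    (hc : ∀ c ∈ gam I S.X₃, ∃ e ∈ gam I S.X₂, S.g.hom e = c) :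
    Function.Exact (barMap I S.f) (barMap I S.g) := by
  intro x
  obtain ⟨x, rfl⟩ := Submodule.Quotient.mk_surjective _ x
  constructor
  · intro h
    rw [barMap_mk, Submodule.Quotient.mk_eq_zero] at h
    obtain ⟨e, he, hge⟩ := hc _ h
    obtain ⟨y, hy⟩ := se_ex hS (x - e) (by rw [map_sub, hge, sub_self])
    refine ⟨Submodule.Quotient.mk y, ?_⟩
    rw [barMap_mk, hy, Submodule.Quotient.eq]
    simpa using he
  · rintro ⟨y, hy⟩
    obtain ⟨y, rfl⟩ := Submodule.Quotient.mk_surjective _ y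
    rw [← hy, barMap_mk, barMap_mk, se_zero]
    rfl

theorem bar_inj (hS : S.ShortExact) (I : Ideal R) : Function.Injective (barMap I S.f) := by
  rw [injective_iff_map_eq_zero]
  intro y hy
  obtain ⟨y, rfl⟩ := Submodule.Quotient.mk_surjective _ y
  rw [barMap_mk, Submodule.Quotient.mk_eq_zero] at hy
  exact (Submodule.Quotient.mk_eq_zero _).2 (gam_of_map S.f.hom (se_inj hS) hy)

theorem tors_lift (hS : S.ShortExact) [Injective S.X₂] (I : Ideal R)
    (h : Subsingleton (LC R I 1 S.X₁)) :
    ∀ c ∈ gam I S.X₃, ∃ e ∈ gam I S.X₂, S.g.hom e = c := by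
  intro c hc
  obtain ⟨e⟩ := LC_one hS I
  have := e.symm.toEquiv.subsingleton
  have h0 : (Submodule.Quotient.mk ⟨c, hc⟩ : gam I S.X₃ ⧸ NN I S) = 0 := Subsingleton.elim _ _
  exact mem_NN.1 ((Submodule.Quotient.mk_eq_zero _).1 h0)

theorem bar_chain [IsNoetherianRing R] (I J : Ideal R) (hIJ : I ≤ J) (xs : List R)
    (hxs : Ideal.span {x | x ∈ xs} = J) (K : ModuleCat.{u} R) (t : ℕ)
    (hvan : ∀ i : ℕ, t < i → Subsingleton (LC R I i K)) (n : ℕ) :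
    ∀ j i, t ≤ j → xs.length < i + n → ExK (barM I (Kc K j)) xs i := by
  induction n with
  | zero =>
    intro j i _ hi c _
    have := Kos_subsingleton (barM I (Kc K j)) xs i hi
    exact ⟨0, Subsingleton.elim _ _⟩
  | succ n ih =>
    intro j i hj hi
    have hS := nextS_exact (Kc K j)
    have hv : Subsingleton (LC R I 1 (Kc K j)) := by
      obtain ⟨e⟩ := LC_iter I K j 0
      have := hvan (0 + j + 1) (by omega)
      exact e.toEquiv.subsingleton
    exact ExK_shift (Z := barM I (Kc K j)) (Z' := barM I (nextS (Kc K j)).X₂)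
      (Z'' := barM I (Kc K (j+1))) (barMap I (nextS (Kc K j)).f) (barMap I (nextS (Kc K j)).g)
      (bar_inj hS I) (barMap_surj I _ (se_surj hS)) (bar_exact hS I (tors_lift hS I hv)) xs i
      (bar_ExK I J hIJ xs hxs _ i) (ih (j+1) (i+1) (by omega) (by omega))

theorem final_alg [IsNoetherianRing R] (I J : Ideal R) (xs : List R)
    (hxs : Ideal.span {x | x ∈ xs} = J) (hS : S.ShortExact)
    (hE : ∀ i, ExK (barM I S.X₂) xs i) (hK : ∀ i, ExK (barM I S.X₃) xs i)
    (F : ModuleCat.{u} R) (p : F ⟶ S.X₁) (hp : Function.Surjective p.hom)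
    (hF : ExK (barM I F) xs 0) :
    Function.Surjective (mulT J (gam I S.X₃ ⧸ NN I S)) ∧
      Function.Injective (mulT J (gam I S.X₃ ⧸ NN I S)) := by
  let D : Submodule R (barM I S.X₂) := LinearMap.ker (barMap I S.g)
  have hD : ∀ i, ExK (ModuleCat.of R D) xs i := fun i =>
    ExK_shift (Z := ModuleCat.of R D) D.subtype (barMap I S.g) D.injective_subtype
      (barMap_surj I _ (se_surj hS)) (by
        intro x
        constructor
        · intro hx; exact ⟨⟨x, hx⟩, rfl⟩
        · rintro ⟨y, rfl⟩; exact y.2) xs i (hE i) (hK (i+1))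
  have hD0 := mulT_surj_of_ExK J (ModuleCat.of R D) xs hxs (hD 0)
  have hD1 := mulT_inj_of_ExK J (ModuleCat.of R D) xs hxs (hD 1)
  have hF0 := mulT_surj_of_ExK J (barM I F) xs hxs hF
  let T : Submodule R S.X₂ := Submodule.comap S.g.hom (gam I S.X₃)
  let q1 : T →ₗ[R] D := LinearMap.codRestrict D ((gam I S.X₂).mkQ ∘ₗ T.subtype) (fun x =>
    (Submodule.Quotient.mk_eq_zero _).2 x.2)
  let q2 : T →ₗ[R] (gam I S.X₃ ⧸ NN I S) := (NN I S).mkQ ∘ₗ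
    LinearMap.codRestrict (gam I S.X₃) (S.g.hom ∘ₗ T.subtype) (fun x => x.2)
  have hq1 : Function.Surjective q1 := by
    rintro ⟨x, hx⟩
    obtain ⟨x, rfl⟩ := Submodule.Quotient.mk_surjective _ x
    have hx' : S.g.hom x ∈ gam I S.X₃ := (Submodule.Quotient.mk_eq_zero _).1 hx
    exact ⟨⟨x, hx'⟩, rfl⟩
  have q1z : ∀ x, q1 x = 0 ↔ x.1 ∈ gam I S.X₂ := fun x =>
    Subtype.ext_iff.trans (Submodule.Quotient.mk_eq_zero _)
  have q2z : ∀ x, q2 x = 0 ↔ ∃ e ∈ gam I S.X₂, S.g.hom e = S.g.hom x.1 := fun x =>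
    (Submodule.Quotient.mk_eq_zero _).trans mem_NN
  have hq2 : Function.Surjective q2 := by
    intro y
    obtain ⟨⟨c, hc⟩, rfl⟩ := Submodule.Quotient.mk_surjective _ y
    obtain ⟨x, rfl⟩ := se_surj hS c
    exact ⟨⟨x, hc⟩, rfl⟩
  obtain ⟨q, hq⟩ := exists_lift_surj q1 q2 hq1 (fun x hx => (q2z x).2 ⟨x.1, (q1z x).1 hx, rfl⟩)
  have hqs : Function.Surjective q := by
    intro y
    obtain ⟨x, rfl⟩ := hq2 y
    exact ⟨q1 x, hq x⟩
  let f : barM I F →ₗ[R] D := LinearMap.codRestrict D (barMap I (p ≫ S.f)) (by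
    intro y
    obtain ⟨y, rfl⟩ := Submodule.Quotient.mk_surjective _ y
    refine (Submodule.Quotient.mk_eq_zero _).2 ?_
    have : S.g.hom ((p ≫ S.f).hom y) = 0 := se_zero (p.hom y)
    rw [this]
    exact zero_mem _)
  have hex : Function.Exact f q := by
    intro x
    obtain ⟨x, rfl⟩ := hq1 x
    rw [hq, q2z]
    constructor
    · rintro ⟨e, he, hge⟩
      obtain ⟨y, hy⟩ := se_ex hS (x.1 - e) (by rw [map_sub, hge, sub_self])
      obtain ⟨z, rfl⟩ := hp y
      refine ⟨Submodule.Quotient.mk z, Subtype.ext ?_⟩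
      refine (Submodule.Quotient.eq _).2 ?_
      have : (p ≫ S.f).hom z = x.1 - e := hy
      change (p ≫ S.f).hom z - x.1 ∈ _
      rw [this]
      simpa using he
    · rintro ⟨z, hz⟩
      obtain ⟨z, rfl⟩ := Submodule.Quotient.mk_surjective _ z
      have h1 : (p ≫ S.f).hom z - x.1 ∈ gam I S.X₂ :=
        (Submodule.Quotient.eq _).1 (congrArg Subtype.val hz)
      refine ⟨-((p ≫ S.f).hom z - x.1), neg_mem h1, ?_⟩
      have : S.g.hom ((p ≫ S.f).hom z) = 0 := se_zero (p.hom z)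
      rw [map_neg, map_sub, this]
      simp
  exact ⟨mulT_surj_of_surj J q hqs hD0, mulT_inj_quot J f q hqs hex hD1 hF0⟩

theorem main_aux [IsNoetherianRing R] (I J : Ideal R) (hIJ : I ≤ J) (K : ModuleCat.{u} R) (s : ℕ)
    (hvan : ∀ i : ℕ, s + 2 < i → Subsingleton (LC R I i K)) :
    Function.Surjective (mulT J (LC R I (s+2) K)) ∧
      Function.Injective (mulT J (LC R I (s+2) K)) := by
  obtain ⟨G, hG⟩ := (isNoetherianRing_iff_ideal_fg R).1 inferInstance J
  have hxs : Ideal.span {x | x ∈ G.toList} = J := by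
    rw [← hG]; congr 1; ext x; simp
  have hS := nextS_exact (Kc K (s+1))
  obtain ⟨e1⟩ := LC_iter I K (s+1) 0
  have h : 0 + (s + 1) + 1 = s + 2 := by omega
  rw [h] at e1
  obtain ⟨e2⟩ := LC_one hS I
  let e : (gam I (nextS (Kc K (s+1))).X₃ ⧸ NN I (nextS (Kc K (s+1)))) ≃ₗ[R] LC R I (s+2) K :=
    e2.symm.trans e1
  obtain ⟨h1, h2⟩ := final_alg I J G.toList hxs hS (bar_ExK I J hIJ _ hxs _)
    (fun i => bar_chain I J hIJ _ hxs K (s+2) hvan (G.toList.length + 1) (s+2) i le_rfl (by omega))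
    (nextS (Kc K s)).X₂ (nextS (Kc K s)).g (se_surj (nextS_exact (Kc K s)))
    (bar_ExK I J hIJ _ hxs _ 0)
  refine ⟨mulT_surj_of_surj J e.toLinearMap e.surjective h1, ?_⟩
  refine mulT_inj_quot J (0 : PUnit.{u+1} →ₗ[R] _) e.toLinearMap e.surjective ?_ h2
    (fun x => ⟨0, Subsingleton.elim _ _⟩)
  intro x
  constructor
  · intro hx
    exact ⟨0, ((map_eq_zero_iff e e.injective).1 hx).symm⟩
  · rintro ⟨y, rfl⟩
    exact map_zero e

end Final

theorem stmt9 (R : Type u) [CommRing R] [IsNoetherianRing R] (I J : Ideal R) (hIJ : I ≤ J)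
    (K : Type u) [AddCommGroup K] [Module R K] (t : ℕ) (ht : 2 ≤ t)
    (hne : ¬ Subsingleton (LC R I t (ModuleCat.of R K)))
    (hvan : ∀ i : ℕ, t < i → Subsingleton (LC R I i (ModuleCat.of R K))) :
    Subsingleton (TorMod R 0 (ModuleCat.of R (R ⧸ J)) (LC R I t (ModuleCat.of R K))) ∧
      Subsingleton (TorMod R 1 (ModuleCat.of R (R ⧸ J)) (LC R I t (ModuleCat.of R K))) := by
  obtain ⟨s, rfl⟩ := Nat.exists_eq_add_of_le' ht
  have h := main_aux I J hIJ (ModuleCat.of R K) s hvan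
  exact ⟨tor_zero J _ h.1, tor_one J _ h.2⟩
end
end

section
/- Let R be a commutative Noetherian ring, I an ideal of R, and M an R-module. If Tor_i^R(R/I, M) = 0 for all 0 ≤ i ≤ cd(I, R), then Tor_i^R(R/I, M) = 0 for all integers i ≥ 0. -/
open CategoryTheory

noncomputable section

universe u

/-- divisibility in injective modules -/
lemma s10_div {R : Type u} [CommRing R] [IsNoetherianRing R] {E : Type u} [AddCommGroup E]
    [Module R E] (hE : Module.Injective R E) (x : R) (m : ℕ) (v' : E) :
    ∃ (k : ℕ) (v : E), x ^ (m + k) • v = x ^ k • v' ∧ ∀ b : R, b • v' = 0 → b • v = 0 := by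
  -- stabilisation
  let f : ℕ →o Ideal R :=
    ⟨fun k => LinearMap.ker (LinearMap.toSpanSingleton R E (x ^ k • v')), by
      intro a b hab r hr
      simp only [LinearMap.mem_ker, LinearMap.toSpanSingleton_apply] at hr ⊢
      obtain ⟨c, rfl⟩ := Nat.exists_eq_add_of_le hab
      rw [pow_add, mul_comm, mul_smul, smul_comm, hr, smul_zero]⟩
  obtain ⟨k, hk⟩ := monotone_stabilizes_iff_noetherian.mpr (inferInstance : IsNoetherian R R) f
  have hk' : ∀ r : R, (x ^ (m + k) * r) • v' = 0 → r • x ^ k • v' = 0 := by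
    intro r hr
    have h1 : r ∈ f (m + k) := by
      change r • x ^ (m + k) • v' = 0
      rw [← hr, smul_smul, mul_comm]
    rw [← hk (m + k) (by omega)] at h1
    exact h1
  let B : Ideal R := LinearMap.ker (LinearMap.toSpanSingleton R E v')
  have hB : ∀ r, r ∈ B ↔ r • v' = 0 := fun r => by simp [B]
  -- φ : R/B → R/B multiplication; quotient by kernel
  let φ : R ⧸ B →ₗ[R] R ⧸ B := LinearMap.lsmul R (R ⧸ B) (x ^ (m + k))
  let ψ : R ⧸ B →ₗ[R] E := B.liftQ (LinearMap.toSpanSingleton R E (x ^ k • v')) (by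
    intro r hr
    simp only [LinearMap.mem_ker, LinearMap.toSpanSingleton_apply]
    rw [smul_comm, (hB r).1 hr, smul_zero])
  have hker : LinearMap.ker φ ≤ LinearMap.ker ψ := by
    intro q hq
    obtain ⟨r, rfl⟩ := Submodule.Quotient.mk_surjective _ q
    simp only [LinearMap.mem_ker] at hq ⊢
    have : x ^ (m + k) * r ∈ B := by
      rw [← Submodule.Quotient.mk_eq_zero]
      exact hq
    exact hk' r ((hB _).1 this)
  let φ' := (LinearMap.ker φ).liftQ φ le_rfl
  have hφ' : Function.Injective φ' := by
    rw [← LinearMap.ker_eq_bot]; exact Submodule.ker_liftQ_eq_bot' _ _ rfl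
  obtain ⟨χ, hχ⟩ := hE.out φ' hφ' ((LinearMap.ker φ).liftQ ψ hker)
  refine ⟨k, χ (Submodule.Quotient.mk 1), ?_, ?_⟩
  · have := hχ (Submodule.Quotient.mk (Submodule.Quotient.mk 1))
    have h2 : χ (x ^ (m + k) • (Submodule.Quotient.mk 1 : R ⧸ B)) = (1 : R) • x ^ k • v' := this
    rw [map_smul, one_smul] at h2
    exact h2
  · intro b hb
    rw [← map_smul, ← Submodule.Quotient.mk_smul, smul_eq_mul, mul_one,
      (Submodule.Quotient.mk_eq_zero B).2 ((hB b).2 hb), map_zero]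

lemma s10_tors {R : Type u} [CommRing R] [IsNoetherianRing R] (E : ℕ → Type u)
    [∀ n, AddCommGroup (E n)] [∀ n, Module R (E n)] (hE : ∀ n, Module.Injective R (E n))
    (d : ∀ n, E n →ₗ[R] E (n + 1)) (hd : ∀ n (x : E n), d (n + 1) (d n x) = 0)
    (hex : ∀ n (z : E (n + 1)), d (n + 1) z = 0 → ∃ w, d n w = z) (S : Finset R) :
    ∀ n, S.card ≤ n → ∀ z : E (n + 1), d (n + 1) z = 0 → (∀ x ∈ S, ∃ a : ℕ, x ^ a • z = 0) →
      ∃ w : E n, d n w = z ∧ (∀ x ∈ S, ∃ a : ℕ, x ^ a • w = 0) := by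
  classical
  induction S using Finset.induction_on with
  | empty =>
    intro n _ z hz _
    obtain ⟨w, hw⟩ := hex n z hz
    exact ⟨w, hw, by simp⟩
  | insert x S hx ih =>
    intro n hn z hz hzt
    rw [Finset.card_insert_of_notMem hx] at hn
    obtain ⟨n, rfl⟩ : ∃ n', n = n' + 1 := ⟨n - 1, by omega⟩
    obtain ⟨w, hw, hwt⟩ := ih (n + 1) (by omega) z hz
      (fun y hy => hzt y (Finset.mem_insert_of_mem hy))
    obtain ⟨a, ha⟩ := hzt x (Finset.mem_insert_self _ _)
    obtain ⟨v', hv', hvt'⟩ := ih n (by omega) (x ^ a • w) (by rw [map_smul, hw, ha]) (by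
      intro y hy
      obtain ⟨b, hb⟩ := hwt y hy
      exact ⟨b, by rw [smul_comm, hb, smul_zero]⟩)
    obtain ⟨k, v, hv, hvt⟩ := s10_div (hE n) x a v'
    refine ⟨w - d n v, by rw [map_sub, hd, hw, sub_zero], ?_⟩
    intro y hy
    rw [Finset.mem_insert] at hy
    rcases hy with rfl | hy
    · refine ⟨a + k, ?_⟩
      rw [smul_sub, ← map_smul, hv, map_smul, hv', smul_smul, ← pow_add, add_comm k a, sub_self]
    · obtain ⟨b, hb⟩ := hwt y hy
      obtain ⟨c, hc⟩ := hvt' y hy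
      refine ⟨b + c, ?_⟩
      have h1 : y ^ (b + c) • w = 0 := by rw [pow_add, mul_comm, mul_smul, hb, smul_zero]
      have h2 : y ^ (b + c) • v = 0 := by rw [pow_add, mul_smul, hvt _ hc, smul_zero]
      rw [smul_sub, ← map_smul, h1, h2, map_zero, sub_zero]

lemma s10_tors_ideal {R : Type u} [CommRing R] [IsNoetherianRing R] (I : Ideal R) :
    ∃ r : ℕ, ∀ (E : ℕ → Type u)
    [∀ n, AddCommGroup (E n)] [∀ n, Module R (E n)] (_ : ∀ n, Module.Injective R (E n))
    (d : ∀ n, E n →ₗ[R] E (n + 1)) (_ : ∀ n (x : E n), d (n + 1) (d n x) = 0)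
    (_ : ∀ n (z : E (n + 1)), d (n + 1) z = 0 → ∃ w, d n w = z),
    ∀ n, r ≤ n → ∀ z : E (n + 1), d (n + 1) z = 0 →
      ∀ t : ℕ, (∀ x ∈ I ^ t, x • z = 0) →
      ∃ w : E n, d n w = z ∧ ∃ s : ℕ, t ≤ s ∧ ∀ x ∈ I ^ s, x • w = 0 := by
  obtain ⟨S, hS⟩ := IsNoetherian.noetherian I
  refine ⟨S.card, fun E _ _ hE d hd hex n hn z hz t ht => ?_⟩
  obtain ⟨w, hw, hwt⟩ := s10_tors E hE d hd hex S n hn z hz (fun x hx =>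
    ⟨t, ht _ (Ideal.pow_mem_pow (hS ▸ Ideal.subset_span hx) t)⟩)
  refine ⟨w, hw, ?_⟩
  let B : Ideal R := LinearMap.ker (LinearMap.toSpanSingleton R (E n) w)
  have hI : I ≤ B.radical := by
    rw [← hS]
    refine Ideal.span_le.2 (fun x hx => ?_)
    obtain ⟨a, ha⟩ := hwt x hx
    exact ⟨a, by simpa [B] using ha⟩
  obtain ⟨k, hk⟩ := Ideal.exists_pow_le_of_le_radical_of_fg hI (IsNoetherian.noetherian I)
  refine ⟨t + k, by omega, fun x hx => ?_⟩
  have : x ∈ B := hk (Ideal.pow_le_pow_right (by omega) hx)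
  simpa [B] using this

/-- the projection between quotients by powers -/
def s10pr {R : Type u} [CommRing R] (I : Ideal R) {t s : ℕ} (h : t ≤ s) :
    ModuleCat.of R (R ⧸ I ^ s) ⟶ ModuleCat.of R (R ⧸ I ^ t) :=
  ModuleCat.ofHom (Submodule.mapQ (I ^ s) (I ^ t) LinearMap.id (Ideal.pow_le_pow_right h))

lemma s10pr_comp {R : Type u} [CommRing R] (I : Ideal R) {t s r : ℕ} (h : t ≤ s) (h' : s ≤ r) :
    s10pr I h' ≫ s10pr I h = s10pr I (h.trans h') := by
  ext
  rfl

/-- All classes in `Ext^i(R/I^t, N)` die in the limit. -/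
def S10Dies {R : Type u} [CommRing R] (I : Ideal R) (i : ℕ) (N : ModuleCat.{u} R) : Prop :=
  ∀ (t : ℕ) (e : Abelian.Ext (ModuleCat.of R (R ⧸ I ^ t)) N i),
    ∃ (s : ℕ) (h : t ≤ s), (Abelian.Ext.mk₀ (s10pr I h)).comp e (zero_add i) = 0

lemma s10_large {R : Type u} [CommRing R] [IsNoetherianRing R] (I : Ideal R) : ∃ r : ℕ, ∀ i, r ≤ i → ∀ N : ModuleCat.{u} R, S10Dies I i N := by
  obtain ⟨r, hr⟩ := s10_tors_ideal I
  refine ⟨r + 1, fun i hi N t e => ?_⟩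
  let Q := InjectiveResolution.of N
  replace hr := hr (fun n => Q.cocomplex.X n)
    (fun n => Module.injective_module_of_injective_object (inj := Q.injective n))
    (fun n => (Q.cocomplex.d n (n + 1)).hom)
    (fun n x => by
      have := Q.cocomplex.d_comp_d n (n + 1) (n + 2)
      exact congr($(this) x))
    (fun n z hz => by
      have h := (ShortComplex.moduleCat_exact_iff _).1 (Q.exact_succ n)
      exact h z hz)
  obtain ⟨n, rfl⟩ : ∃ n, i = n + 1 := ⟨i - 1, by omega⟩
  obtain ⟨f, hf, rfl⟩ := Q.extMk_surjective e (n + 2) rfl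
  obtain ⟨w, hw, s, hs, hws⟩ := hr n (by omega) (f (Submodule.Quotient.mk 1 : R ⧸ I ^ t))
    (congr($hf (Submodule.Quotient.mk 1 : R ⧸ I ^ t))) t (fun x hx => by
      rw [← map_smul, ← Submodule.Quotient.mk_smul, smul_eq_mul, mul_one,
        (Submodule.Quotient.mk_eq_zero _).2 hx, map_zero])
  refine ⟨s, hs, ?_⟩
  rw [Q.mk₀_comp_extMk, Q.extMk_eq_zero_iff _ _ _ _ n rfl]
  refine ⟨ModuleCat.ofHom ((I ^ s).liftQ (LinearMap.toSpanSingleton R _ w) (by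
    intro x hx
    exact hws x hx)), ?_⟩
  ext
  simp only [ModuleCat.hom_comp]
  change (Q.cocomplex.d n (n + 1)).hom ((1 : R) • w) = f (Submodule.Quotient.mk 1 : R ⧸ I ^ t)
  rw [one_smul, hw]

lemma s10_dies_sum {R : Type u} [CommRing R] (I : Ideal R) (i t : ℕ) (N : ModuleCat.{u} R)
    (e e' : Abelian.Ext (ModuleCat.of R (R ⧸ I ^ t)) N i)
    (he : ∃ (s : ℕ) (h : t ≤ s), (Abelian.Ext.mk₀ (s10pr I h)).comp e (zero_add i) = 0)
    (he' : ∃ (s : ℕ) (h : t ≤ s), (Abelian.Ext.mk₀ (s10pr I h)).comp e' (zero_add i) = 0) :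
    ∃ (s : ℕ) (h : t ≤ s), (Abelian.Ext.mk₀ (s10pr I h)).comp (e + e') (zero_add i) = 0 := by
  obtain ⟨s, h, hs⟩ := he
  obtain ⟨s', h', hs'⟩ := he'
  refine ⟨s + s', by omega, ?_⟩
  rw [Abelian.Ext.comp_add, ← s10pr_comp I h (show s ≤ s + s' by omega)]
  have h1 : (Abelian.Ext.mk₀ (s10pr I (show s ≤ s + s' by omega) ≫ s10pr I h)).comp e (zero_add i) = 0 := by
    rw [← Abelian.Ext.mk₀_comp_mk₀_assoc, hs, Abelian.Ext.comp_zero]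
  have h2 : (Abelian.Ext.mk₀ (s10pr I (show s ≤ s + s' by omega) ≫ s10pr I h)).comp e' (zero_add i) = 0 := by
    rw [s10pr_comp, ← s10pr_comp I h' (show s' ≤ s + s' by omega),
      ← Abelian.Ext.mk₀_comp_mk₀_assoc, hs', Abelian.Ext.comp_zero]
  rw [h1, h2, add_zero]

/-- Ext from a finite module to a free module. -/
lemma s10_ext_free {R : Type u} [CommRing R] [IsNoetherianRing R] (ι : Type u) (i : ℕ) :
    ∀ (A : ModuleCat.{u} R) [Module.Finite R A]
      (e : Abelian.Ext A (ModuleCat.of R (ι →₀ R)) i),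
      e ∈ AddSubgroup.closure {x | ∃ (y : Abelian.Ext A (ModuleCat.of R R) i)
        (f : ModuleCat.of R R ⟶ ModuleCat.of R (ι →₀ R)),
          x = y.comp (Abelian.Ext.mk₀ f) (add_zero i)} := by
  induction i with
  | zero =>
    intro A _ e
    classical
    obtain ⟨g, rfl⟩ := (Abelian.Ext.mk₀_bijective _ _).2 e
    -- finite support
    obtain ⟨G, hG⟩ := (Module.Finite.fg_top : (⊤ : Submodule R A).FG)
    let T : Finset ι := G.biUnion (fun a => (g a : ι →₀ R).support)
    have hT : ∀ a : A, ∀ j, j ∉ T → (g a : ι →₀ R) j = 0 := by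
      intro a j hj
      have ha : a ∈ Submodule.span R (G : Set A) := hG ▸ Submodule.mem_top
      have hle : Submodule.span R (G : Set A) ≤ LinearMap.ker ((Finsupp.lapply j : (ι →₀ R) →ₗ[R] R) ∘ₗ g.hom) := by
        refine Submodule.span_le.2 (fun b hb => ?_)
        have : j ∉ (g b : ι →₀ R).support := fun h => hj (Finset.mem_biUnion.2 ⟨b, hb, h⟩)
        simpa using this
      exact hle ha
    have hg : g = ∑ j ∈ T, (ModuleCat.ofHom ((Finsupp.lapply j : (ι →₀ R) →ₗ[R] R) ∘ₗ g.hom) ≫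
        ModuleCat.ofHom (Finsupp.lsingle j : R →ₗ[R] (ι →₀ R))) := by
      ext a j
      simp only [ModuleCat.hom_sum, LinearMap.sum_apply]
      rw [Finsupp.finsetSum_apply]
      simp only [ModuleCat.hom_comp, ModuleCat.hom_ofHom, LinearMap.comp_apply,
        Finsupp.lapply_apply, Finsupp.lsingle_apply, Finsupp.single_apply]
      rw [Finset.sum_ite_eq' T j]
      split_ifs with hj
      · rfl
      · exact hT a j hj
    have key : ∀ T' : Finset ι, Abelian.Ext.mk₀ (∑ j ∈ T', (ModuleCat.ofHom ((Finsupp.lapply j : (ι →₀ R) →ₗ[R] R) ∘ₗ g.hom) ≫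
        ModuleCat.ofHom (Finsupp.lsingle j : R →ₗ[R] (ι →₀ R)))) ∈ AddSubgroup.closure {x | ∃ (y : Abelian.Ext A (ModuleCat.of R R) 0)
        (f : ModuleCat.of R R ⟶ ModuleCat.of R (ι →₀ R)),
          x = y.comp (Abelian.Ext.mk₀ f) (add_zero 0)} := by
      intro T'
      induction T' using Finset.induction_on with
      | empty => 
        rw [Finset.sum_empty, Abelian.Ext.mk₀_zero]
        exact AddSubgroup.zero_mem _
      | insert j T' hj ih =>
        rw [Finset.sum_insert hj, Abelian.Ext.mk₀_add]
        refine AddSubgroup.add_mem _ (AddSubgroup.subset_closure ?_) ih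
        exact ⟨Abelian.Ext.mk₀ _, _, (Abelian.Ext.mk₀_comp_mk₀ _ _).symm⟩
    rw [hg]
    exact key T
  | succ i ih =>
    intro A _ e
    obtain ⟨m, f, hf⟩ := Module.Finite.exists_fin' R A
    let f' : (ULift.{u} (Fin m) → R) →ₗ[R] A :=
      f ∘ₗ (LinearEquiv.funCongrLeft R R (Equiv.ulift.{u} (α := Fin m)).symm).toLinearMap
    have hf' : Function.Surjective f' := hf.comp (LinearEquiv.surjective _)
    have hS : f'.shortComplexKer.ShortExact := LinearMap.shortExact_shortComplexKer hf'
    have : Projective f'.shortComplexKer.X₂ :=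
      ModuleCat.projective_of_free (Pi.basisFun R (ULift.{u} (Fin m)))
    obtain ⟨x, rfl⟩ := precomp_extClass_surjective_of_projective_X₂ _ hS i e
    have : Module.Finite R f'.shortComplexKer.X₁ :=
      inferInstanceAs (Module.Finite R (LinearMap.ker f'))
    have hx := ih f'.shortComplexKer.X₁ x
    induction hx using AddSubgroup.closure_induction with
    | mem x hx =>
      obtain ⟨y, g, rfl⟩ := hx
      refine AddSubgroup.subset_closure ⟨hS.extClass.comp y (add_comm 1 i), g, ?_⟩
      exact (Abelian.Ext.comp_assoc_of_third_deg_zero _ _ _ _).symm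
    | zero => rw [map_zero]; exact AddSubgroup.zero_mem _
    | add x y _ _ hx hy => rw [map_add]; exact AddSubgroup.add_mem _ hx hy
    | neg x _ hx => rw [map_neg]; exact AddSubgroup.neg_mem _ hx

lemma s10_dies_free {R : Type u} [CommRing R] [IsNoetherianRing R] (I : Ideal R) (i : ℕ)
    (h : S10Dies I i (ModuleCat.of R R)) (ι : Type u) :
    S10Dies I i (ModuleCat.of R (ι →₀ R)) := by
  intro t e
  have : Module.Finite R (ModuleCat.of R (R ⧸ I ^ t)) :=
    inferInstanceAs (Module.Finite R (R ⧸ I ^ t))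
  have he := s10_ext_free ι i _ e
  induction he using AddSubgroup.closure_induction with
  | mem x hx =>
    obtain ⟨y, g, rfl⟩ := hx
    obtain ⟨s, hs, hy⟩ := h t y
    refine ⟨s, hs, ?_⟩
    rw [← Abelian.Ext.comp_assoc_of_third_deg_zero, hy, Abelian.Ext.zero_comp]
  | zero => exact ⟨t, le_rfl, by rw [Abelian.Ext.comp_zero]⟩
  | add x y _ _ hx hy => exact s10_dies_sum I i t _ x y hx hy
  | neg x _ hx =>
    obtain ⟨s, hs, hy⟩ := hx
    exact ⟨s, hs, by rw [Abelian.Ext.comp_neg, hy, neg_zero]⟩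

lemma s10_dies_step {R : Type u} [CommRing R] [IsNoetherianRing R] (I : Ideal R) (i : ℕ)
    (h : S10Dies I i (ModuleCat.of R R)) (h' : ∀ N : ModuleCat.{u} R, S10Dies I (i + 1) N)
    (N : ModuleCat.{u} R) : S10Dies I i N := by
  intro t e
  let p : (N →₀ R) →ₗ[R] N := Finsupp.linearCombination R id
  have hp : Function.Surjective p := Finsupp.linearCombination_id_surjective R N
  have hS : p.shortComplexKer.ShortExact := LinearMap.shortExact_shortComplexKer hp
  obtain ⟨s, hs, h1⟩ := h' _ t (e.comp hS.extClass rfl)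
  obtain ⟨y, hy⟩ := Abelian.Ext.covariant_sequence_exact₃ _ hS
    ((Abelian.Ext.mk₀ (s10pr I hs)).comp e (zero_add i)) rfl (by
      rw [← h1]
      exact Abelian.Ext.comp_assoc _ _ _ _ _ (by omega))
  obtain ⟨s', hs', h2⟩ := s10_dies_free I i h N s y
  refine ⟨s', hs.trans hs', ?_⟩
  rw [← s10pr_comp I hs hs', ← Abelian.Ext.mk₀_comp_mk₀_assoc]
  have h3 : (Abelian.Ext.mk₀ (s10pr I hs')).comp
    ((Abelian.Ext.mk₀ (s10pr I hs)).comp e (zero_add i)) (zero_add i) = 0 := by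
    rw [← hy, ← Abelian.Ext.comp_assoc_of_third_deg_zero, h2, Abelian.Ext.zero_comp]
  exact h3

lemma s10_dies_all {R : Type u} [CommRing R] [IsNoetherianRing R] (I : Ideal R) (c : ℕ)
    (h : ∀ i, c < i → S10Dies I i (ModuleCat.of R R)) (r : ℕ)
    (hr : ∀ i, r ≤ i → ∀ N : ModuleCat.{u} R, S10Dies I i N) :
    ∀ i, c < i → ∀ N : ModuleCat.{u} R, S10Dies I i N := by
  have : ∀ k i, c < i → r ≤ i + k → ∀ N : ModuleCat.{u} R, S10Dies I i N := by
    intro k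
    induction k with
    | zero => intro i _ hi; exact hr i hi
    | succ k ih =>
      intro i hc hi N
      exact s10_dies_step I i (h i hc) (ih (i + 1) (by omega) (by omega)) N
  intro i hi
  exact this r i hi (by omega)

lemma s10_ext_pi {R : Type u} [CommRing R] (A N : ModuleCat.{u} R) (i m : ℕ)
    (h : Subsingleton (Abelian.Ext A N i)) :
    ∀ e : Abelian.Ext (ModuleCat.of R (Fin m → A)) N i, e = 0 := by
  intro e
  have hid : 𝟙 (ModuleCat.of R (Fin m → A)) = ∑ j : Fin m,
      (ModuleCat.ofHom (LinearMap.proj j : (Fin m → A) →ₗ[R] A)) ≫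
        ModuleCat.ofHom (LinearMap.single R (fun _ : Fin m => (A : Type u)) j) := by
    ext x j
    simp only [ModuleCat.hom_sum, LinearMap.sum_apply, ModuleCat.hom_comp, ModuleCat.hom_ofHom,
      LinearMap.comp_apply, LinearMap.proj_apply, LinearMap.single_apply, ModuleCat.hom_id,
      LinearMap.id_apply, Finset.sum_apply, Finset.sum_pi_single]
    simp
  rw [← Abelian.Ext.mk₀_id_comp e, hid, Abelian.Ext.mk₀_sum, Abelian.Ext.sum_comp]
  refine Finset.sum_eq_zero (fun j _ => ?_)
  rw [← Abelian.Ext.mk₀_comp_mk₀_assoc,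
    Subsingleton.elim ((Abelian.Ext.mk₀ (ModuleCat.ofHom (LinearMap.single R
      (fun _ : Fin m => (A : Type u)) j))).comp e (zero_add i)) 0, Abelian.Ext.comp_zero]

lemma s10_ext_killed_one {R : Type u} [CommRing R] [IsNoetherianRing R] (I : Ideal R)
    (N : ModuleCat.{u} R) (d : ℕ)
    (h : ∀ i ≤ d, Subsingleton (Abelian.Ext (ModuleCat.of R (R ⧸ I)) N i)) :
    ∀ i ≤ d, ∀ (T : ModuleCat.{u} R) [Module.Finite R T],
      (∀ x ∈ I, ∀ y : T, x • y = 0) → ∀ e : Abelian.Ext T N i, e = 0 := by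
  intro i
  induction i with
  | zero =>
    intro hi T _ hT e
    obtain ⟨g, rfl⟩ := (Abelian.Ext.mk₀_bijective _ _).2 e
    rw [Abelian.Ext.mk₀_eq_zero_iff]
    ext y
    let q : ModuleCat.of R (R ⧸ I) ⟶ T :=
      ModuleCat.ofHom (Submodule.liftQ I (LinearMap.toSpanSingleton R T y) (by
        intro x hx
        exact hT x hx y))
    have h0 : q ≫ g = 0 := by
      rw [← Abelian.Ext.mk₀_eq_zero_iff]
      exact (h 0 hi).elim _ _
    have h1 : g ((1 : R) • y) = 0 := congr($h0 (Submodule.Quotient.mk 1 : R ⧸ I))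
    rw [one_smul] at h1
    exact h1
  | succ i ih =>
    intro hi T _ hT e
    -- surjection from a power of R/I
    obtain ⟨m, f, hf⟩ := Module.Finite.exists_fin' R T
    let p : (Fin m → R ⧸ I) →ₗ[R] T :=
      ∑ j : Fin m, (Submodule.liftQ I (LinearMap.toSpanSingleton R T (f (Pi.single j 1))) (by
        intro x hx
        exact hT x hx _)) ∘ₗ LinearMap.proj j
    have hp : Function.Surjective p := by
      intro y
      obtain ⟨v, rfl⟩ := hf y
      refine ⟨fun j => Submodule.Quotient.mk (v j), ?_⟩
      have : ∀ j, Submodule.liftQ I (LinearMap.toSpanSingleton R T (f (Pi.single j 1))) (by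
        intro x hx
        exact hT x hx _) (Submodule.Quotient.mk (v j)) = v j • f (Pi.single j 1) := fun j => rfl
      simp only [p, LinearMap.sum_apply, LinearMap.comp_apply, LinearMap.proj_apply]
      rw [Finset.sum_congr rfl (fun j _ => this j)]
      conv_rhs => rw [pi_eq_sum_univ' v]
      rw [map_sum]
      refine Finset.sum_congr rfl (fun j _ => ?_)
      rw [map_smul]
    have hS : p.shortComplexKer.ShortExact := LinearMap.shortExact_shortComplexKer hp
    have : Module.Finite R p.shortComplexKer.X₁ :=
      inferInstanceAs (Module.Finite R (LinearMap.ker p))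
    obtain ⟨x, rfl⟩ := Abelian.Ext.contravariant_sequence_exact₃ hS N e
      (s10_ext_pi (ModuleCat.of R (R ⧸ I)) N (i + 1) m (h (i + 1) hi) _) (add_comm 1 i)
    rw [ih (by omega) p.shortComplexKer.X₁ (by
      rintro x hx ⟨y, hy⟩
      apply Subtype.ext
      funext j
      change x • y j = 0
      obtain ⟨r, hr⟩ := Submodule.Quotient.mk_surjective _ (y j)
      rw [← hr, ← Submodule.Quotient.mk_smul, Submodule.Quotient.mk_eq_zero]
      exact I.mul_mem_right _ hx) x, Abelian.Ext.comp_zero]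

lemma s10_ext_killed {R : Type u} [CommRing R] [IsNoetherianRing R] (I : Ideal R)
    (N : ModuleCat.{u} R) (d : ℕ)
    (h : ∀ i ≤ d, Subsingleton (Abelian.Ext (ModuleCat.of R (R ⧸ I)) N i)) (i : ℕ) (hi : i ≤ d)
    (s : ℕ) : ∀ (T : ModuleCat.{u} R) [Module.Finite R T],
      (∀ x ∈ I ^ s, ∀ y : T, x • y = 0) → ∀ e : Abelian.Ext T N i, e = 0 := by
  induction s with
  | zero =>
    intro T _ hT e
    exact s10_ext_killed_one I N d h i hi T (fun x _ y => hT x (by simp) y) e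
  | succ s ih =>
    intro T _ hT e
    let p : T →ₗ[R] (T ⧸ (I • (⊤ : Submodule R T))) := Submodule.mkQ _
    have hS : p.shortComplexKer.ShortExact :=
      LinearMap.shortExact_shortComplexKer (Submodule.mkQ_surjective _)
    have : Module.Finite R p.shortComplexKer.X₁ :=
      inferInstanceAs (Module.Finite R (LinearMap.ker p))
    have : Module.Finite R p.shortComplexKer.X₃ :=
      inferInstanceAs (Module.Finite R (T ⧸ (I • (⊤ : Submodule R T))))
    obtain ⟨x, rfl⟩ := Abelian.Ext.contravariant_sequence_exact₂ hS N e
      (ih p.shortComplexKer.X₁ (by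
        rintro x hx ⟨y, hy⟩
        apply Subtype.ext
        change x • y = 0
        have hy' : y ∈ I • (⊤ : Submodule R T) := by
          simpa [p] using hy
        clear hy
        induction hy' using Submodule.smul_induction_on' with
        | smul r hr n _ =>
          rw [smul_smul]
          exact hT _ (by rw [pow_succ]; exact Ideal.mul_mem_mul hx hr) _
        | add a _ b _ ha hb => rw [smul_add, ha, hb, add_zero]) _)
    rw [s10_ext_killed_one I N d h i hi p.shortComplexKer.X₃ (by
      intro x hx y
      obtain ⟨y, rfl⟩ := Submodule.Quotient.mk_surjective _ y
      rw [← Submodule.Quotient.mk_smul]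
      exact (Submodule.Quotient.mk_eq_zero _).2 
        (Submodule.smul_mem_smul hx Submodule.mem_top)) x, Abelian.Ext.comp_zero]

lemma s10_ext_main {R : Type u} [CommRing R] [IsNoetherianRing R] (I : Ideal R) (c : ℕ)
    (hc : ∀ i, c < i → S10Dies I i (ModuleCat.of R R)) (N : ModuleCat.{u} R)
    (h : ∀ i ≤ c, Subsingleton (Abelian.Ext (ModuleCat.of R (R ⧸ I)) N i)) :
    ∀ i, Subsingleton (Abelian.Ext (ModuleCat.of R (R ⧸ I)) N i) := by
  obtain ⟨r, hr⟩ := s10_large I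
  have hd := s10_dies_all I c hc r hr
  intro i
  induction i using Nat.strong_induction_on with
  | _ i ih =>
    by_cases hi : i ≤ c
    · exact h i hi
    obtain ⟨d, rfl⟩ : ∃ d, i = d + 1 := ⟨i - 1, by omega⟩
    refine subsingleton_of_forall_eq 0 (fun e => ?_)
    let α : ModuleCat.of R (R ⧸ I ^ 1) ⟶ ModuleCat.of R (R ⧸ I) :=
      ModuleCat.ofHom (Submodule.mapQ (I ^ 1) I LinearMap.id (by rw [pow_one]; exact le_rfl))
    obtain ⟨s, hs, h1⟩ := hd (d + 1) (by omega) N 1 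
      ((Abelian.Ext.mk₀ α).comp e (zero_add _))
    let p : (R ⧸ I ^ s) →ₗ[R] (R ⧸ I) :=
      Submodule.mapQ (I ^ s) I LinearMap.id (Ideal.pow_le_self (by omega))
    have hp : Function.Surjective p := by
      intro y
      obtain ⟨y, rfl⟩ := Submodule.Quotient.mk_surjective _ y
      exact ⟨Submodule.Quotient.mk y, rfl⟩
    have hS : p.shortComplexKer.ShortExact := LinearMap.shortExact_shortComplexKer hp
    have : Module.Finite R p.shortComplexKer.X₁ :=
      inferInstanceAs (Module.Finite R (LinearMap.ker p))
    rw [Abelian.Ext.mk₀_comp_mk₀_assoc] at h1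
    have h2 : s10pr I hs ≫ α = p.shortComplexKer.g := by
      ext
      rfl
    rw [h2] at h1
    obtain ⟨x, hx⟩ := Abelian.Ext.contravariant_sequence_exact₃ hS N e h1 (add_comm 1 d)
    rw [← hx, s10_ext_killed I N d (fun i hi => ih i (by omega)) d le_rfl s
      p.shortComplexKer.X₁ (by
        rintro x hx ⟨y, hy⟩
        apply Subtype.ext
        change x • y = 0
        obtain ⟨r, hr⟩ := Submodule.Quotient.mk_surjective _ y
        rw [← hr, ← Submodule.Quotient.mk_smul, Submodule.Quotient.mk_eq_zero]
        exact (I ^ s).mul_mem_right _ hx) x, Abelian.Ext.comp_zero]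

lemma s10_dual_exact {R : Type u} [CommRing R] {X Y Z : Type u} [AddCommGroup X] [AddCommGroup Y]
    [AddCommGroup Z] [Module R X] [Module R Y] [Module R Z] (f : X →ₗ[R] Y) (g : Y →ₗ[R] Z) :
    (∀ y, g y = 0 → ∃ x, f x = y) ↔
      ∀ χ : CharacterModule Y, CharacterModule.dual f χ = 0 →
        ∃ c, CharacterModule.dual g c = χ := by
  constructor
  · intro h χ hχ
    let q : (Y ⧸ LinearMap.ker g) →ₗ[R] Z := (LinearMap.ker g).liftQ g le_rfl
    have hq : Function.Injective q := by
      rw [← LinearMap.ker_eq_bot]; exact Submodule.ker_liftQ_eq_bot' _ _ rfl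
    let χ' : CharacterModule (Y ⧸ LinearMap.ker g) :=
      QuotientAddGroup.lift (LinearMap.ker g).toAddSubgroup χ (by
        intro y hy
        obtain ⟨x, rfl⟩ := h y hy
        exact congr($hχ x))
    obtain ⟨c, hc⟩ := CharacterModule.dual_surjective_of_injective q hq χ'
    refine ⟨c, ?_⟩
    ext y
    exact congr($hc (Submodule.Quotient.mk y))
  · intro h y hy
    by_contra hne
    have h0 : (Submodule.Quotient.mk y : Y ⧸ LinearMap.range f) ≠ 0 := by
      rw [Ne, Submodule.Quotient.mk_eq_zero]
      exact hne
    obtain ⟨c, hc⟩ := CharacterModule.exists_character_apply_ne_zero_of_ne_zero h0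
    obtain ⟨c', hc'⟩ := h (CharacterModule.dual (LinearMap.range f).mkQ c) (by
      ext x
      change c (Submodule.Quotient.mk (f x)) = 0
      rw [(Submodule.Quotient.mk_eq_zero _).2 (LinearMap.mem_range_self f x), map_zero])
    apply hc
    have h1 : c' (g y) = c (Submodule.Quotient.mk y) := congr($hc' y)
    rw [← h1, hy, map_zero]

lemma s10_homEquiv_dual {R : Type u} [CommRing R] {A X Y : Type u} [AddCommGroup X]
    [AddCommGroup Y] [AddCommGroup A] [Module R X] [Module R Y] [Module R A] (f : X →ₗ[R] Y)
    (c : A →ₗ[R] CharacterModule Y) :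
    CharacterModule.dual (f.lTensor A) (CharacterModule.homEquiv c) =
      CharacterModule.homEquiv (CharacterModule.dual f ∘ₗ c) := by
  apply CharacterModule.homEquiv.symm.injective
  rw [LinearEquiv.symm_apply_apply]
  rfl

lemma s10_tensor_exact {R : Type u} [CommRing R] (A : Type u) {X Y Z : Type u} [AddCommGroup X]
    [AddCommGroup Y] [AddCommGroup A] [Module R A]
    [AddCommGroup Z] [Module R X] [Module R Y] [Module R Z] (f : X →ₗ[R] Y) (g : Y →ₗ[R] Z) :
    (∀ y, g.lTensor A y = 0 → ∃ x, f.lTensor A x = y) ↔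
      ∀ χ : A →ₗ[R] CharacterModule Y, CharacterModule.dual f ∘ₗ χ = 0 →
        ∃ c : A →ₗ[R] CharacterModule Z, CharacterModule.dual g ∘ₗ c = χ := by
  rw [s10_dual_exact]
  constructor
  · intro h χ hχ
    obtain ⟨c, hc⟩ := h (CharacterModule.homEquiv χ) (by
      rw [s10_homEquiv_dual, hχ, map_zero])
    obtain ⟨c, rfl⟩ := CharacterModule.homEquiv.surjective c
    rw [s10_homEquiv_dual] at hc
    exact ⟨c, CharacterModule.homEquiv.injective hc⟩
  · intro h χ hχ
    obtain ⟨χ, rfl⟩ := CharacterModule.homEquiv.surjective χ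
    rw [s10_homEquiv_dual] at hχ
    obtain ⟨c, hc⟩ := h χ (CharacterModule.homEquiv.injective (by rw [hχ, map_zero]))
    exact ⟨CharacterModule.homEquiv c, by rw [s10_homEquiv_dual, hc]⟩

lemma s10_tor_iff {R : Type u} [CommRing R] (A M : ModuleCat.{u} R)
    (P : ProjectiveResolution M) (i : ℕ) :
    Subsingleton (TorMod R i A M) ↔
      ∀ y, (P.complex.d i ((ComplexShape.down ℕ).next i)).hom.lTensor A y = 0 →
        ∃ x, (P.complex.d (i + 1) i).hom.lTensor A x = y := by
  have e := P.isoLeftDerivedObj ((MonoidalCategory.tensoringLeft (ModuleCat.{u} R)).obj A) i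
  have h1 : Subsingleton (TorMod R i A M) ↔ Limits.IsZero (TorMod R i A M) :=
    (ModuleCat.isZero_iff_subsingleton (M := TorMod R i A M)).symm
  rw [h1]
  have h2 : Limits.IsZero (TorMod R i A M) ↔ Limits.IsZero _ := e.isZero_iff
  rw [h2]
  have h3 := HomologicalComplex.exactAt_iff_isZero_homology
    ((((MonoidalCategory.tensoringLeft (ModuleCat.{u} R)).obj A).mapHomologicalComplex
      (ComplexShape.down ℕ)).obj P.complex) i
  rw [HomologicalComplex.exactAt_iff' _ (i + 1) i _ (by simp) rfl,
    ShortComplex.moduleCat_exact_iff] at h3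
  exact h3.symm

lemma s10_tor_iff_succ {R : Type u} [CommRing R] (A M : ModuleCat.{u} R)
    (P : ProjectiveResolution M) (i : ℕ) :
    Subsingleton (TorMod R (i + 1) A M) ↔
      ∀ χ : A →ₗ[R] CharacterModule (P.complex.X (i + 1)),
        CharacterModule.dual (P.complex.d (i + 2) (i + 1)).hom ∘ₗ χ = 0 →
        ∃ c : A →ₗ[R] CharacterModule (P.complex.X i),
          CharacterModule.dual (P.complex.d (i + 1) i).hom ∘ₗ c = χ := by
  rw [s10_tor_iff A M P, ChainComplex.next_nat_succ, ← s10_tensor_exact]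

lemma s10_tor_iff_zero {R : Type u} [CommRing R] (A M : ModuleCat.{u} R)
    (P : ProjectiveResolution M) :
    Subsingleton (TorMod R 0 A M) ↔
      ∀ χ : A →ₗ[R] CharacterModule (P.complex.X 0),
        CharacterModule.dual (P.complex.d 1 0).hom ∘ₗ χ = 0 → χ = 0 := by
  rw [s10_tor_iff A M P, s10_tensor_exact]
  have : P.complex.d 0 ((ComplexShape.down ℕ).next 0) = 0 := by
    rw [ChainComplex.next_nat_zero]
    exact P.complex.shape _ _ (by simp)
  rw [this]
  refine forall₂_congr (fun χ hχ => ?_)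
  rw [ModuleCat.hom_zero, CharacterModule.dual_zero]
  simp only [LinearMap.zero_comp, exists_const]
  exact eq_comm

section Shift

variable {R : Type u} [CommRing R] (E : ℕ → ModuleCat.{u} R) (d : ∀ n, E n ⟶ E (n + 1))

/-- cocycles -/
abbrev s10Z (n : ℕ) : ModuleCat.{u} R := ModuleCat.of R (LinearMap.ker (d n).hom)

/-- short complex of cocycles -/
abbrev s10S (hd : ∀ n (x : E n), d (n + 1) (d n x) = 0) (n : ℕ) : ShortComplex (ModuleCat.{u} R) :=
  ShortComplex.mk (X₁ := s10Z E d n) (X₂ := E n) (X₃ := s10Z E d (n + 1))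
    (ModuleCat.ofHom (LinearMap.ker (d n).hom).subtype)
    (ModuleCat.ofHom ((d n).hom.codRestrict (LinearMap.ker (d (n + 1)).hom) (fun x => hd n x))) (by
      ext x
      exact x.2)

lemma s10S_exact (hd : ∀ n (x : E n), d (n + 1) (d n x) = 0)
    (hex : ∀ n (z : E (n + 1)), d (n + 1) z = 0 → ∃ w, d n w = z) (n : ℕ) :
    (s10S E d hd n).ShortExact where
  exact := by
    rw [ShortComplex.moduleCat_exact_iff]
    intro x hx
    exact ⟨⟨x, congrArg Subtype.val hx⟩, rfl⟩
  mono_f := by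
    rw [ModuleCat.mono_iff_injective]
    exact Subtype.val_injective
  epi_g := by
    rw [ModuleCat.epi_iff_surjective]
    rintro ⟨z, hz⟩
    obtain ⟨w, hw⟩ := hex n z hz
    exact ⟨w, Subtype.ext hw⟩

lemma s10_shift (hE : ∀ n, Injective (E n)) (hd : ∀ n (x : E n), d (n + 1) (d n x) = 0)
    (hex : ∀ n (z : E (n + 1)), d (n + 1) z = 0 → ∃ w, d n w = z) (A : ModuleCat.{u} R) (i : ℕ) :
    ∀ n k, n + i = k → (Subsingleton (Abelian.Ext A (s10Z E d n) (i + 1)) ↔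
      ∀ χ : A ⟶ E (k + 1), χ ≫ d (k + 1) = 0 → ∃ c : A ⟶ E k, c ≫ d k = χ) := by
  induction i with
  | zero =>
    rintro n _ rfl
    have hS := s10S_exact E d hd hex n
    constructor
    · intro h χ hχ
      let χ' : A ⟶ (s10S E d hd n).X₃ := ModuleCat.ofHom (χ.hom.codRestrict
        (LinearMap.ker (d (n + 1)).hom) (fun x => congr($hχ x)))
      obtain ⟨y, hy⟩ := Abelian.Ext.covariant_sequence_exact₃ A hS (Abelian.Ext.mk₀ χ') rfl
        (h.elim _ _)
      obtain ⟨c, rfl⟩ := (Abelian.Ext.mk₀_bijective _ _).2 y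
      rw [Abelian.Ext.mk₀_comp_mk₀] at hy
      have h1 := (Abelian.Ext.mk₀_bijective _ _).1 hy
      refine ⟨c, ?_⟩
      ext x
      exact congrArg Subtype.val (congr($h1 x))
    · intro h
      refine subsingleton_of_forall_eq 0 (fun e => ?_)
      have : Injective (s10S E d hd n).X₂ := hE n
      obtain ⟨x, rfl⟩ := Abelian.Ext.covariant_sequence_exact₁ A hS e
        (Abelian.Ext.eq_zero_of_injective _) rfl
      obtain ⟨χ, rfl⟩ := (Abelian.Ext.mk₀_bijective _ _).2 x
      obtain ⟨c, hc⟩ := h (χ ≫ (ModuleCat.ofHom (LinearMap.ker (d (n + 1)).hom).subtype)) (by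
        ext x
        exact (χ x).2)
      let c' : A ⟶ (s10S E d hd n).X₂ := c
      have : χ = c' ≫ (s10S E d hd n).g := by
        ext x
        have h2 := congr($hc x)
        exact h2.symm
      rw [this, ← Abelian.Ext.mk₀_comp_mk₀, Abelian.Ext.comp_assoc _ _ _ _ (zero_add 1) (by omega),
        hS.comp_extClass, Abelian.Ext.comp_zero]
  | succ i ih =>
    intro n k hk
    rw [← ih (n + 1) k (by omega)]
    have hS := s10S_exact E d hd hex n
    have : Injective (s10S E d hd n).X₂ := hE n
    constructor
    · intro h
      refine subsingleton_of_forall_eq 0 (fun e => ?_)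
      obtain ⟨y, hy⟩ := Abelian.Ext.covariant_sequence_exact₃ A hS e rfl (h.elim _ _)
      rw [← hy, Abelian.Ext.eq_zero_of_injective y, Abelian.Ext.zero_comp]
    · intro h
      refine subsingleton_of_forall_eq 0 (fun e => ?_)
      obtain ⟨x, rfl⟩ := Abelian.Ext.covariant_sequence_exact₁ A hS e
        (Abelian.Ext.eq_zero_of_injective _) rfl
      have hx : x = 0 := h.elim _ _
      rw [hx, Abelian.Ext.zero_comp]

lemma s10_shift_zero (A : ModuleCat.{u} R) :
    Subsingleton (Abelian.Ext A (s10Z E d 0) 0) ↔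
      ∀ χ : A ⟶ E 0, χ ≫ d 0 = 0 → χ = 0 := by
  constructor
  · intro h χ hχ
    let χ' : A ⟶ s10Z E d 0 := ModuleCat.ofHom (χ.hom.codRestrict
        (LinearMap.ker (d 0).hom) (fun x => congr($hχ x)))
    have h1 : χ' = 0 := (Abelian.Ext.mk₀_eq_zero_iff _).1 (h.elim _ _)
    ext x
    exact congrArg Subtype.val (congr($h1 x))
  · intro h
    refine subsingleton_of_forall_eq 0 (fun e => ?_)
    obtain ⟨χ, rfl⟩ := (Abelian.Ext.mk₀_bijective _ _).2 e
    have h1 := h (χ ≫ (ModuleCat.ofHom (LinearMap.ker (d 0).hom).subtype)) (by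
        ext x
        exact (χ x).2)
    rw [Abelian.Ext.mk₀_eq_zero_iff]
    ext x
    have h2 := congr($h1 x)
    exact h2

end Shift

lemma s10_tor_ext {R : Type u} [CommRing R] (A M : ModuleCat.{u} R) :
    ∃ N : ModuleCat.{u} R, ∀ i : ℕ,
      Subsingleton (TorMod R i A M) ↔ Subsingleton (Abelian.Ext A N i) := by
  let P := ProjectiveResolution.of M
  let E : ℕ → ModuleCat.{u} R := fun n => ModuleCat.of R (CharacterModule (P.complex.X n))
  let d : ∀ n, E n ⟶ E (n + 1) := fun n =>
    ModuleCat.ofHom (CharacterModule.dual (P.complex.d (n + 1) n).hom)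
  have hE : ∀ n, Injective (E n) := by
    intro n
    have : Module.Projective R (P.complex.X n) :=
      (IsProjective.iff_projective _).2 (P.projective n)
    have := Module.Flat.iff_characterModule_injective.1
      (inferInstance : Module.Flat R (P.complex.X n))
    exact Module.injective_object_of_injective_module (inj := this)
  have hd : ∀ n (x : E n), d (n + 1) (d n x) = 0 := by
    intro n x
    have h1 := P.complex.d_comp_d (n + 2) (n + 1) n
    apply CharacterModule.ext
    intro y
    have h2 : (P.complex.d (n + 1) n) ((P.complex.d (n + 2) (n + 1)) y) = 0 := congr($h1 y)
    have h3 : (x : CharacterModule (P.complex.X n))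
      ((P.complex.d (n + 1) n) ((P.complex.d (n + 2) (n + 1)) y)) = 0 := by rw [h2, map_zero]
    exact h3
  have hex : ∀ n (z : E (n + 1)), d (n + 1) z = 0 → ∃ w, d n w = z := by
    intro n
    exact (s10_dual_exact (P.complex.d (n + 2) (n + 1)).hom (P.complex.d (n + 1) n).hom).1
      ((ShortComplex.moduleCat_exact_iff _).1 (P.exact_succ n))
  refine ⟨s10Z E d 0, fun i => ?_⟩
  cases i with
  | zero =>
    rw [s10_tor_iff_zero A M P, s10_shift_zero]
    constructor
    · intro h χ hχ
      ext1
      exact h χ.hom (congrArg ModuleCat.Hom.hom hχ)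
    · intro h χ hχ
      exact congrArg ModuleCat.Hom.hom (h (ModuleCat.ofHom χ) (by ext1; exact hχ))
  | succ i =>
    rw [s10_tor_iff_succ A M P, s10_shift E d hE hd hex A i 0 i (zero_add i)]
    constructor
    · intro h χ hχ
      obtain ⟨c, hc⟩ := h χ.hom (congrArg ModuleCat.Hom.hom hχ)
      exact ⟨ModuleCat.ofHom c, by ext1; exact hc⟩
    · intro h χ hχ
      obtain ⟨c, hc⟩ := (h (ModuleCat.ofHom χ) (by ext1; exact hχ))
      exact ⟨c.hom, congrArg ModuleCat.Hom.hom hc⟩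

lemma s10_cplx {D : Type*} [Category* D] [Abelian D] (K : ChainComplex D ℕ) (j : ℕ) {Q : D}
    [Injective Q] (a : K.X (j + 1) ⟶ Q) (ha : K.d (j + 2) (j + 1) ≫ a = 0)
    (h0 : K.homologyι (j + 1) ≫ K.descOpcycles a (j + 2) (by simp) ha = 0) :
    ∃ ψ : K.X j ⟶ Q, K.d (j + 1) j ≫ ψ = a := by
  have hex : (ShortComplex.mk (K.homologyι (j + 1)) (K.fromOpcycles (j + 1) j) (by simp)).Exact :=
    ShortComplex.exact_of_f_is_kernel _ (K.homologyIsKernel (j + 1) j (by simp))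
  refine ⟨hex.descToInjective _ h0, ?_⟩
  have h1 := hex.comp_descToInjective _ h0
  dsimp only at h1
  rw [← K.p_fromOpcycles, Category.assoc, h1, K.p_descOpcycles]

lemma s10_cplx_map {D : Type*} [Category* D] [Abelian D] {K L : ChainComplex D ℕ} (φ : K ⟶ L)
    (j : ℕ) {Q : D}
    [Injective Q] (a : L.X (j + 1) ⟶ Q) (ha : L.d (j + 2) (j + 1) ≫ a = 0)
    (h0 : HomologicalComplex.homologyMap φ (j + 1) ≫ L.homologyι (j + 1) ≫
      L.descOpcycles a (j + 2) (by simp) ha = 0) :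
    ∃ ψ : K.X j ⟶ Q, K.d (j + 1) j ≫ ψ = φ.f (j + 1) ≫ a := by
  refine s10_cplx K j (φ.f (j + 1) ≫ a) (by rw [← φ.comm_assoc, ha, Limits.comp_zero]) ?_
  rw [← h0, HomologicalComplex.homologyι_naturality_assoc]
  congr 1
  rw [← cancel_epi (K.pOpcycles (j + 1)), HomologicalComplex.p_descOpcycles,
      HomologicalComplex.p_opcyclesMap_assoc, HomologicalComplex.p_descOpcycles]

lemma s10_derived {C D : Type*} [Category* C] [Category* D] [Abelian C] [Abelian D]
    [EnoughProjectives C]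
    (F : C ⥤ D) [F.Additive] {X : C} (P : ProjectiveResolution X) (j : ℕ) {Q : D} [Injective Q]
    (a : F.obj (P.complex.X (j + 1)) ⟶ Q) (ha : F.map (P.complex.d (j + 2) (j + 1)) ≫ a = 0) :
    ∃ ξ : (F.leftDerived (j + 1)).obj X ⟶ Q, ∀ {X' : C} (P' : ProjectiveResolution X')
      (f : X' ⟶ X) (φ : ProjectiveResolution.Hom P' P f),
      (F.leftDerived (j + 1)).map f ≫ ξ = 0 → ∃ ψ : F.obj (P'.complex.X j) ⟶ Q,
        F.map (P'.complex.d (j + 1) j) ≫ ψ = F.map (φ.hom.f (j + 1)) ≫ a := by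
  let L := (F.mapHomologicalComplex (ComplexShape.down ℕ)).obj P.complex
  let b : L.homology (j + 1) ⟶ Q :=
    L.homologyι (j + 1) ≫ HomologicalComplex.descOpcycles L (i := j + 1) a (j + 2) (by simp) ha
  refine ⟨(P.isoLeftDerivedObj F (j + 1)).hom ≫ b, ?_⟩
  intro X' P' f φ h
  have hnat := ProjectiveResolution.isoLeftDerivedObj_hom_naturality f P' P φ.hom
    (by simpa using φ.hom_f_zero_comp_π_f_zero) F (j + 1)
  have h' := ((Category.assoc _ _ _).symm.trans (congrArg (· ≫ b) hnat)).symm.trans h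
  let Φ := (F.mapHomologicalComplex (ComplexShape.down ℕ)).map φ.hom
  have h2 : HomologicalComplex.homologyMap Φ (j + 1) ≫ b = 0 := by
    let ε : (F.leftDerived (j + 1)).obj X' ≅ HomologicalComplex.homology
      ((F.mapHomologicalComplex (ComplexShape.down ℕ)).obj P'.complex) (j + 1) :=
      P'.isoLeftDerivedObj F (j + 1)
    have h3 : ε.hom ≫ HomologicalComplex.homologyMap Φ (j + 1) ≫ b
      = ε.hom ≫ 0 :=
      (Category.assoc _ _ _).symm.trans (h'.trans Limits.comp_zero.symm)
    exact (Iso.cancel_iso_hom_left ε _ _).1 h3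
  exact s10_cplx_map Φ j a ha h2

lemma s10_lc_dies {R : Type u} [CommRing R] (I : Ideal R) (i : ℕ) (Y : ModuleCat.{u} R)
    (h : Subsingleton (LC R I i Y)) (t : ℕ)
    (x : ((Ext R (ModuleCat.{u} R) i).obj (Opposite.op (ModuleCat.of R (R ⧸ I ^ t)))).obj Y) :
    ∃ (s : ℕ) (h : t ≤ s), ((Ext R (ModuleCat.{u} R) i).map (s10pr I h).op).app Y x = 0 := by
  let G := localCohomology.diagram (localCohomology.idealPowersDiagram I) i
  have := localCohomology.hasColimitDiagram.{u, 0} (localCohomology.idealPowersDiagram I) i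
  have hc := Limits.isColimitOfPreserves ((evaluation _ _).obj Y) (Limits.colimit.isColimit G)
  have h' : Subsingleton ((((evaluation _ _).obj Y).mapCocone (Limits.colimit.cocone G)).pt) := h
  have : Limits.PreservesFilteredColimitsOfSize.{0, 0} (forget (ModuleCat.{u} R)) :=
    Limits.preservesSmallestFilteredColimits_of_preservesFilteredColimits _
  obtain ⟨k, f, g, hfg⟩ := Limits.Concrete.isColimit_exists_of_rep_eq.{u}
    (G ⋙ (evaluation _ _).obj Y) hc (i := Opposite.op (Opposite.op t))
    (j := Opposite.op (Opposite.op t)) x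
    (0 : ((Ext R (ModuleCat.{u} R) i).obj (Opposite.op (ModuleCat.of R (R ⧸ I ^ t)))).obj Y)
    (h'.elim _ _)
  refine ⟨k.unop.unop, f.unop.unop.down.down, ?_⟩
  refine Eq.trans hfg ?_
  exact map_zero (((Ext R (ModuleCat.{u} R) i).map (s10pr I g.unop.unop.down.down).op).app Y).hom

lemma s10_bridge {R : Type u} [CommRing R] (I : Ideal R) (j : ℕ) (Y : ModuleCat.{u} R)
    (h : Subsingleton (LC R I (j + 1) Y)) : S10Dies I (j + 1) Y := by
  intro t e
  let P (t : ℕ) := ProjectiveResolution.of (ModuleCat.of R (R ⧸ I ^ t))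
  obtain ⟨g, hg, rfl⟩ := (P t).extMk_surjective e (j + 2) rfl
  let F : ModuleCat.{u} R ⥤ (ModuleCat.{u} R)ᵒᵖ := ((linearYoneda R (ModuleCat.{u} R)).obj Y).rightOp
  let Q : (ModuleCat.{u} R)ᵒᵖ := Opposite.op (ModuleCat.of R R)
  let a (X : ModuleCat.{u} R) (g : X ⟶ Y) : F.obj X ⟶ Q :=
    Quiver.Hom.op (ModuleCat.ofHom (LinearMap.toSpanSingleton R (X ⟶ Y) g))
  have ha : ∀ {X X' : ModuleCat.{u} R} (f : X' ⟶ X) (g : X ⟶ Y), F.map f ≫ a X g = a X' (f ≫ g) := by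
    intro X X' f g
    apply Quiver.Hom.unop_inj
    apply ModuleCat.hom_ext
    apply LinearMap.ext_ring
    change f ≫ ((1 : R) • g) = (1 : R) • (f ≫ g)
    rw [one_smul, one_smul]
  have ha0 : ∀ X : ModuleCat.{u} R, a X 0 = 0 := by
    intro X
    apply Quiver.Hom.unop_inj
    apply ModuleCat.hom_ext
    apply LinearMap.ext_ring
    change (1 : R) • (0 : X ⟶ Y) = 0
    rw [smul_zero]
  have hp : Projective (ModuleCat.of R R) := ModuleCat.projective_of_free (Module.Basis.singleton Unit R)
  have hinj : Injective Q := inferInstance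
  obtain ⟨ξ, hξ⟩ := s10_derived F (P t) j (a _ g) (by rw [ha, hg, ha0])
  obtain ⟨s, hs, hx⟩ := s10_lc_dies I (j + 1) Y h t (ξ.unop.hom (1 : R))
  let Φ : ProjectiveResolution.Hom (P s) (P t) (s10pr I hs) :=
    ⟨ProjectiveResolution.lift (s10pr I hs) (P s) (P t),
      congrArg (fun f => f.f 0) (ProjectiveResolution.lift_commutes (s10pr I hs) (P s) (P t))⟩
  obtain ⟨ψ, hψ⟩ := hξ (P s) (s10pr I hs) Φ (by
    apply Quiver.Hom.unop_inj
    apply ModuleCat.hom_ext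
    apply LinearMap.ext_ring
    exact hx)
  refine ⟨s, hs, ?_⟩
  rw [ProjectiveResolution.mk₀_comp_extMk _ _ _ _ Φ,
    ProjectiveResolution.extMk_eq_zero_iff _ _ _ _ _ j rfl]
  refine ⟨ψ.unop.hom (1 : R), ?_⟩
  rw [ha] at hψ
  have h2 := congrArg (fun f => f.unop.hom (1 : R)) hψ
  refine Eq.trans ?_ (h2.trans ?_)
  · rfl
  · exact one_smul R _

theorem stmt10 (R : Type u) [CommRing R] [IsNoetherianRing R] (I : Ideal R)
    (M : Type u) [AddCommGroup M] [Module R M] (n : ℕ)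
    (hcd₁ : ∀ i : ℕ, n < i → Subsingleton (LC R I i (ModuleCat.of R R)))
    (hcd₂ : ∀ m : ℕ, (∀ i : ℕ, m < i → Subsingleton (LC R I i (ModuleCat.of R R))) → n ≤ m)
    (h : ∀ i : ℕ, i ≤ n →
      Subsingleton (TorMod R i (ModuleCat.of R (R ⧸ I)) (ModuleCat.of R M))) :
    ∀ i : ℕ, Subsingleton (TorMod R i (ModuleCat.of R (R ⧸ I)) (ModuleCat.of R M)) := by
  obtain ⟨N, hN⟩ := s10_tor_ext (ModuleCat.of R (R ⧸ I)) (ModuleCat.of R M)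
  intro i
  rw [hN]
  refine s10_ext_main I n (fun i hi => ?_) N (fun i hi => (hN i).1 (h i hi)) i
  obtain ⟨j, rfl⟩ : ∃ j, i = j + 1 := ⟨i - 1, by omega⟩
  exact s10_bridge I j _ (hcd₁ _ hi)
end
end
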